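/- arXiv:1612.03573 — 4 statements merged into one kernel-verified Lean document; each statement's English description precedes it below -/
import Mathlib

section
/- Let G be a group and H, K subgroups of G such that, writing π : G → G/Z(G) for the natural projection, the images π(H) and π(K) are both normal in G/Z(G), intersect trivially, and generate G/Z(G) (so G/Z(G) is the internal direct product of π(H) and π(K)). Suppose moreover that π(K) is perfect. Then: (1) the derived subgroup K' is perfect; and (2) [H, K] = 1, i.e. every element of H commutes with every element of K. -/
open Subgroup commutatorElement in
/-- Commutator subgroups only depend on the first argument modulo the center. -/
theorem Subgroup.commutator_le_commutator_of_map_center_le {G : Type*} [Group G]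
    {A B : Subgroup G} (C : Subgroup G)
    (h : A.map (QuotientGroup.mk' (center G)) ≤ B.map (QuotientGroup.mk' (center G))) :
    ⁅A, C⁆ ≤ ⁅B, C⁆ := by
  refine commutator_le.2 fun a ha c hc => ?_
  obtain ⟨b, hb, hba⟩ := h (mem_map_of_mem _ ha)
  obtain ⟨z, hz, rfl⟩ := (QuotientGroup.mk'_eq_mk' _).1 hba
  have hzc : ⁅z, c⁆ = 1 := commutatorElement_eq_one_iff_mul_comm.2 (mem_center_iff.1 hz c).symm
  rw [commutatorElement_mul_left_eq_conj_mul, hzc]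
  simpa using commutator_mem_commutator hb hc

/-- Lemma 7.3: let `H, K ≤ G` with `G/Z(G)` the internal direct product of the
images of `H` and `K`, and suppose the image of `K` is perfect. Then `K'` is
perfect and `[H, K] = 1`. -/
theorem perfect_lifting (G : Type*) [Group G] (H K : Subgroup G)
    (hHnorm : (H.map (QuotientGroup.mk' (Subgroup.center G))).Normal)
    (hKnorm : (K.map (QuotientGroup.mk' (Subgroup.center G))).Normal)
    (hinf : H.map (QuotientGroup.mk' (Subgroup.center G)) ⊓
        K.map (QuotientGroup.mk' (Subgroup.center G)) = ⊥)
    (hsup : H.map (QuotientGroup.mk' (Subgroup.center G)) ⊔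
        K.map (QuotientGroup.mk' (Subgroup.center G)) = ⊤)
    (hKperf : ⁅K.map (QuotientGroup.mk' (Subgroup.center G)),
        K.map (QuotientGroup.mk' (Subgroup.center G))⁆ =
        K.map (QuotientGroup.mk' (Subgroup.center G))) :
    ⁅(⁅K, K⁆ : Subgroup G), (⁅K, K⁆ : Subgroup G)⁆ = ⁅K, K⁆ ∧
    ∀ h ∈ H, ∀ k ∈ K, h * k = k * h := by
  set π := QuotientGroup.mk' (Subgroup.center G) with hπ
  have hK : K.map π ≤ (⁅K, K⁆ : Subgroup G).map π := by
    rw [Subgroup.map_commutator, hKperf]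
  have hle (C : Subgroup G) : ⁅K, C⁆ ≤ ⁅(⁅K, K⁆ : Subgroup G), C⁆ :=
    Subgroup.commutator_le_commutator_of_map_center_le C hK
  refine ⟨le_antisymm (Subgroup.commutator_le_self _) ?_, ?_⟩
  · calc ⁅K, K⁆ ≤ ⁅(⁅K, K⁆ : Subgroup G), K⁆ := hle K
      _ = ⁅K, (⁅K, K⁆ : Subgroup G)⁆ := Subgroup.commutator_comm _ _
      _ ≤ ⁅(⁅K, K⁆ : Subgroup G), (⁅K, K⁆ : Subgroup G)⁆ := hle _
  · have hcenter : ⁅H, K⁆ ≤ Subgroup.center G := by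
      rw [← QuotientGroup.ker_mk' (Subgroup.center G), ← hπ, ← (Subgroup.map_eq_bot_iff _),
        Subgroup.map_commutator]
      exact Subgroup.commutator_eq_bot_of_disjoint (disjoint_iff.2 hinf)
    have hHKK : ⁅⁅H, K⁆, K⁆ = ⊥ :=
      le_bot_iff.1 <| (Subgroup.commutator_mono hcenter le_rfl).trans
        (Subgroup.commutator_center_left K).le
    have hKKH : ⁅⁅K, K⁆, H⁆ = ⊥ := Subgroup.commutator_commutator_eq_bot_of_rotate
      (by rwa [Subgroup.commutator_comm K H]) hHKK
    intro h hh k hk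
    have hKH : ⁅K, H⁆ = ⊥ := le_bot_iff.1 ((hle H).trans hKKH.le)
    exact Subgroup.mem_centralizer_iff.1
      (Subgroup.commutator_eq_bot_iff_le_centralizer.1 hKH hk) h hh
end

section
/- There exist a finite group G and subgroups Q₁, Q₂, Q₃ of G, each perfect and centrally indecomposable, with [Qᵢ, Qⱼ] = 1 for i ≠ j and Q₁Q₂Q₃ = G, such that: (1) each Qᵢ is a characteristic subgroup of G; (2) there is a second group structure ∘ on the underlying set of G, with the same identity, satisfying (q₁q₂q₃) ∘ (q₁'q₂'q₃') = (q₁'q₁)(q₂q₂')(q₃q₃') for all qᵢ, qᵢ' ∈ Qᵢ (i.e. the group obtained from G by replacing Q₁ with its opposite); and (3) some automorphism of (G, ∘) maps Q₁ onto Q₂, so that Q₁ and Q₂ are not characteristic subgroups of (G, ∘). -/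
/-- A group `Q` is centrally indecomposable if whenever `Q = A·B` with
`[A, B] = 1`, one of `A`, `B` is contained in the center of `Q`. -/
def CentrallyIndecomposable (Q : Type*) [Group Q] : Prop :=
  ∀ A B : Subgroup Q, (∀ a ∈ A, ∀ b ∈ B, a * b = b * a) →
    (∀ q : Q, ∃ a ∈ A, ∃ b ∈ B, q = a * b) →
    A ≤ Subgroup.center Q ∨ B ≤ Subgroup.center Q

namespace TwistedCentralProduct

/-- The join of two proper normal subgroups is proper. -/
def NormalJoinIrreducible (Q : Type*) [Group Q] : Prop :=
  ∀ A B : Subgroup Q, A.Normal → B.Normal → A ⊔ B = ⊤ → A = ⊤ ∨ B = ⊤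

section GroupTheory

open scoped commutatorElement

variable {Q T : Type*} [Group Q] [Group T]

theorem NormalJoinIrreducible.of_mulEquiv (h : NormalJoinIrreducible Q) (e : Q ≃* T) :
    NormalJoinIrreducible T := by
  intro A B hA hB hAB
  have hsup : A.comap e.toMonoidHom ⊔ B.comap e.toMonoidHom = ⊤ := by
    rw [Subgroup.comap_sup_eq _ _ _ e.surjective, hAB, Subgroup.comap_top]
  refine (h _ _ (hA.comap _) (hB.comap _) hsup).imp ?_ ?_ <;>
  · intro h
    rw [← Subgroup.comap_top e.toMonoidHom] at h
    exact Subgroup.comap_injective e.surjective h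

/-- If `A` and an abelian normal subgroup generate a perfect group, then `A` is everything. -/
theorem eq_top_of_sup_eq_top (hQ : commutator Q = ⊤) (A K : Subgroup Q) (hA : A.Normal)
    (hK : ∀ x ∈ K, ∀ y ∈ K, x * y = y * x) (h : A ⊔ K = ⊤) : A = ⊤ := by
  have key : ∀ q : Q, ∃ k ∈ K, (q : Q ⧸ A) = (k : Q ⧸ A) := by
    intro q
    obtain ⟨a, ha, k, hk, rfl⟩ := (Subgroup.mem_sup_of_normal_left (s := A) (t := K)).1
      (h ▸ Subgroup.mem_top q)
    refine ⟨k, hk, ?_⟩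
    rw [QuotientGroup.mk_mul, (QuotientGroup.eq_one_iff a).2 ha, one_mul]
  rw [eq_top_iff, ← hQ, commutator_def, Subgroup.commutator_le]
  intro x _ y _
  obtain ⟨k, hk, hxk⟩ := key x
  obtain ⟨l, hl, hyl⟩ := key y
  have hkl : ⁅k, l⁆ = 1 := commutatorElement_eq_one_iff_mul_comm.2 (hK k hk l hl)
  rw [← QuotientGroup.eq_one_iff]
  change ⁅(x : Q ⧸ A), (y : Q ⧸ A)⁆ = 1
  rw [hxk, hyl]
  change ((⁅k, l⁆ : Q) : Q ⧸ A) = 1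
  rw [hkl]; rfl

theorem NormalJoinIrreducible.of_surjective (hT : NormalJoinIrreducible T)
    (hQ : commutator Q = ⊤) (f : Q →* T) (hf : Function.Surjective f)
    (hker : ∀ x ∈ f.ker, ∀ y ∈ f.ker, x * y = y * x) : NormalJoinIrreducible Q := by
  intro A B hA hB hAB
  have hsup : A.map f ⊔ B.map f = ⊤ := by
    rw [← Subgroup.map_sup, hAB, Subgroup.map_top_of_surjective f hf]
  refine (hT _ _ (hA.map f hf) (hB.map f hf) hsup).imp ?_ ?_ <;>
  · intro h
    refine eq_top_of_sup_eq_top hQ _ f.ker ‹_› hker ?_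
    rw [← Subgroup.comap_map_eq, h, Subgroup.comap_top]

theorem commutator_eq_top_of_surjective (f : Q →* T) (hf : Function.Surjective f)
    (hT : commutator T = ⊤) (hker : f.ker ≤ commutator Q) : commutator Q = ⊤ := by
  have h : (commutator Q).map f = ⊤ := by
    rw [commutator_def, Subgroup.map_commutator, Subgroup.map_top_of_surjective f hf,
      ← commutator_def, hT]
  rw [← sup_eq_left.2 hker, ← Subgroup.comap_map_eq, h, Subgroup.comap_top]

theorem NormalJoinIrreducible.centrallyIndecomposable (h : NormalJoinIrreducible Q) :
    CentrallyIndecomposable Q := by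
  intro A B hcomm hprod
  have hA : A.Normal := ⟨fun x hx q => by
    obtain ⟨a, ha, b, hb, rfl⟩ := hprod q
    have : a * b * x * (a * b)⁻¹ = a * x * a⁻¹ := by
      rw [mul_assoc a, ← hcomm x hx b hb]; group
    rw [this]
    exact A.mul_mem (A.mul_mem ha hx) (A.inv_mem ha)⟩
  have hB : B.Normal := ⟨fun x hx q => by
    obtain ⟨a, ha, b, hb, rfl⟩ := hprod q
    have hy : b * x * b⁻¹ ∈ B := B.mul_mem (B.mul_mem hb hx) (B.inv_mem hb)
    have : a * b * x * (a * b)⁻¹ = b * x * b⁻¹ := by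
      have := hcomm a ha _ hy
      calc a * b * x * (a * b)⁻¹ = a * (b * x * b⁻¹) * a⁻¹ := by group
        _ = _ := by rw [this]; group
    rwa [this]⟩
  have hsup : A ⊔ B = ⊤ := by
    rw [eq_top_iff]
    intro q _
    obtain ⟨a, ha, b, hb, rfl⟩ := hprod q
    exact Subgroup.mul_mem_sup ha hb
  rcases h A B hA hB hsup with rfl | rfl
  · exact Or.inr fun b hb => Subgroup.mem_center_iff.2 fun g => hcomm g trivial b hb
  · exact Or.inl fun a ha => Subgroup.mem_center_iff.2 fun g => (hcomm a ha g trivial).symm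

/-- If a group is generated by the conjugates of an element of prime order `p`, and `p ^ 2` does not
divide its order, then proper normal subgroups have proper join. -/
theorem NormalJoinIrreducible.of_prime_order [Finite Q] {p : ℕ} (hp : p.Prime) (a : Q)
    (ha : a ^ p = 1) (hgen : Subgroup.normalClosure {a} = ⊤) (hcard : ¬ p ^ 2 ∣ Nat.card Q) :
    NormalJoinIrreducible Q := by
  intro A B hA hB hAB
  have key : ∀ C : Subgroup Q, C.Normal → C ≠ ⊤ → p ∣ C.index := by
    intro C hC hne
    have hmem : a ∉ C := fun h => hne <| top_le_iff.1 <| hgen ▸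
      Subgroup.normalClosure_le_normal (Set.singleton_subset_iff.2 h)
    have hord : orderOf (a : Q ⧸ C) = p := by
      have := Fact.mk hp
      refine orderOf_eq_prime ?_ fun h => hmem ((QuotientGroup.eq_one_iff a).1 h)
      rw [← QuotientGroup.mk_pow, ha]; rfl
    rw [← hord]
    exact orderOf_dvd_natCard _
  by_contra! hne
  have hidx : A.relIndex B * B.index = (A ⊓ B).index := by
    rw [← Subgroup.inf_relIndex_right, Subgroup.relIndex_mul_index inf_le_right]
  have hA' : A.relIndex B = A.index := by
    rw [← Subgroup.relIndex_sup_right (K := A) B, sup_comm, hAB, Subgroup.relIndex_top_right]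
  refine hcard (dvd_trans ?_ (A ⊓ B).index_dvd_card)
  rw [← hidx, hA', sq]
  exact mul_dvd_mul (key A hA hne.1) (key B hB hne.2)

/-- A perfect join-irreducible normal subgroup is contained in one of three normal subgroups
generating the group. -/
theorem le_of_normalJoinIrreducible (N : Fin 3 → Subgroup Q) (hN : ∀ i, (N i).Normal)
    (hsup : N 0 ⊔ N 1 ⊔ N 2 = ⊤) (R : Subgroup Q) (hR : R.Normal) (hperf : ⁅R, R⁆ = R)
    (hirr : NormalJoinIrreducible R) : ∃ i, R ≤ N i := by
  have hirr' : ∀ A B : Subgroup Q, A.Normal → B.Normal → A ⊔ B = R → A = R ∨ B = R := by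
    intro A B hA hB hAB
    have hAR : A ≤ R := hAB ▸ le_sup_left
    have hBR : B ≤ R := hAB ▸ le_sup_right
    have h := Subgroup.subgroupOf_sup hAR hBR
    rw [hAB, Subgroup.subgroupOf_self] at h
    refine (hirr _ _ (hA.subgroupOf R) (hB.subgroupOf R) h.symm).imp ?_ ?_
    · exact fun h => le_antisymm hAR (Subgroup.subgroupOf_eq_top.1 h)
    · exact fun h => le_antisymm hBR (Subgroup.subgroupOf_eq_top.1 h)
  have hcomm : ⁅R, N 0⁆ ⊔ ⁅R, N 1⁆ ⊔ ⁅R, N 2⁆ = R := by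
    refine le_antisymm (sup_le (sup_le ?_ ?_) ?_) ?_
    iterate 3 exact Subgroup.commutator_le_left _ _
    set C := ⁅R, N 0⁆ ⊔ ⁅R, N 1⁆ ⊔ ⁅R, N 2⁆
    have hC : C.Normal := inferInstance
    have hle : ∀ i, N i ≤ (Subgroup.centralizer
        (R.map (QuotientGroup.mk' C) : Set (Q ⧸ C))).comap (QuotientGroup.mk' C) := by
      intro i x hx
      rw [Subgroup.mem_comap, Subgroup.mem_centralizer_iff]
      rintro _ ⟨r, hr, rfl⟩
      rw [← commutatorElement_eq_one_iff_mul_comm, ← map_commutatorElement,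
        QuotientGroup.mk'_apply, QuotientGroup.eq_one_iff]
      have hrx := Subgroup.commutator_mem_commutator hr hx
      fin_cases i
      · exact (le_sup_left.trans le_sup_left : _ ≤ C) hrx
      · exact (le_sup_right.trans le_sup_left : _ ≤ C) hrx
      · exact (le_sup_right : _ ≤ C) hrx
    have htop := top_le_iff.1 (hsup ▸ sup_le (sup_le (hle 0) (hle 1)) (hle 2))
    conv_lhs => rw [← hperf]
    rw [Subgroup.commutator_le]
    intro r hr s _
    have hs : s ∈ _ := htop ▸ Subgroup.mem_top s
    rw [Subgroup.mem_comap, Subgroup.mem_centralizer_iff] at hs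
    have := hs _ ⟨r, hr, rfl⟩
    rwa [← commutatorElement_eq_one_iff_mul_comm, ← map_commutatorElement,
        QuotientGroup.mk'_apply, QuotientGroup.eq_one_iff] at this
  have hfin : ∀ i, ⁅R, N i⁆ = R → ∃ i, R ≤ N i := fun i h =>
    ⟨i, h ▸ Subgroup.commutator_le_right R (N i)⟩
  rcases hirr' _ _ inferInstance inferInstance hcomm with h | h
  · rcases hirr' _ _ inferInstance inferInstance h with h | h
    · exact hfin 0 h
    · exact hfin 1 h
  · exact hfin 2 h

end GroupTheory

section BinaryIcosahedral

open Matrix.SpecialLinearGroup (toLin')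
open scoped commutatorElement

/-- The plane `𝔽₁₁²`. -/
abbrev V := Fin 2 → ZMod 11

/-- The group `SL₂(11)`. -/
abbrev SL := Matrix.SpecialLinearGroup (Fin 2) (ZMod 11)

/-- The standard symplectic form on `𝔽₁₁²`. -/
def area (v w : V) : ZMod 11 := v 0 * w 1 - v 1 * w 0

/-- A map commuting with the binary icosahedral group; it sends the first column of a matrix of
that group to the second one. -/
def column (x : V) : V :=
  ![x 1 ^ 9 * (-1 + 4 * (x 0 * x 1) ^ 5 + 6 * (x 0 * x 1) ^ 10),
    x 0 ^ 9 * (1 + 4 * (x 0 * x 1) ^ 5 + 5 * (x 0 * x 1) ^ 10)]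

/-- A generator of order `5` of the binary icosahedral group. -/
def genA : SL := ⟨!![3, 0; 0, 4], by decide⟩

/-- A second generator of the binary icosahedral group. -/
def genB : SL := ⟨!![5, 1; 9, 2], by decide⟩

/-- The binary icosahedral group `SL₂(5)` inside `SL₂(11)`. -/
def icosahedral : Subgroup SL :=
  Subgroup.closure {genA, genB}

theorem forall_vec {P : V → Prop} (h : ∀ p r : ZMod 11, P ![p, r]) (x : V) : P x := by
  have := h (x 0) (x 1)
  rwa [← List.ofFn_inj.1 (by simp : List.ofFn x = List.ofFn ![x 0, x 1])] at this

theorem column_genA (x : V) :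
    column (toLin' genA x) = toLin' genA (column x) := by
  revert x
  refine forall_vec fun p r => ?_
  revert p r
  decide +kernel

theorem column_genB (x : V) :
    column (toLin' genB x) = toLin' genB (column x) := by
  revert x
  refine forall_vec fun p r => ?_
  revert p r
  decide +kernel

theorem column_three_smul (x : V) :
    column ((3 : ZMod 11) • x) = (4 : ZMod 11) • column x := by
  revert x
  refine forall_vec fun p r => ?_
  revert p r
  decide +kernel

theorem area_column {x : V} : x ≠ 0 → area x (column x) = 1 := by
  refine forall_vec (P := fun x => x ≠ 0 → area x (column x) = 1) (fun p r => ?_) x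
  revert p r
  decide +kernel

theorem pow_five_eq_one_of_column {x : V} {t : ZMod 11} : x ≠ 0 → t ≠ 0 →
    t • column ((5 : ZMod 11) • x + (9 * t) • column x) = x + (2 * t) • column x → t ^ 5 = 1 := by
  refine forall_vec (P := fun x => x ≠ 0 → t ≠ 0 → t • column ((5 : ZMod 11) • x +
    (9 * t) • column x) = x + (2 * t) • column x → t ^ 5 = 1) (fun p r => ?_) x
  revert p r t
  decide +kernel

theorem area_toLin' (g : SL) (v w : V) : area (toLin' g v) (toLin' g w) = area v w := by
  have h := g.2
  rw [Matrix.det_fin_two] at h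
  simp only [area, Matrix.SpecialLinearGroup.toLin'_apply, Matrix.toLin'_apply, Matrix.mulVec,
    dotProduct, Fin.sum_univ_two]
  linear_combination (v 0 * w 1 - v 1 * w 0) * h

theorem column_toLin' {g : SL} (hg : g ∈ icosahedral) (x : V) :
    column (toLin' g x) = toLin' g (column x) := by
  induction hg using Subgroup.closure_induction generalizing x with
  | mem g hg =>
    rcases hg with rfl | rfl
    · exact column_genA x
    · exact column_genB x
  | one => simp
  | mul g h _ _ hg hh => rw [map_mul, LinearEquiv.mul_apply, LinearEquiv.mul_apply, hg, hh]
  | inv g _ hg =>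
    have h := hg (toLin' g⁻¹ x)
    rw [← LinearEquiv.mul_apply, ← map_mul, mul_inv_cancel, map_one, LinearEquiv.coe_one, id_eq] at h
    rw [h, ← LinearEquiv.mul_apply, ← map_mul, inv_mul_cancel, map_one, LinearEquiv.coe_one, id_eq]

theorem fifteen_ne_zero : (15 : ZMod 11) ≠ 0 := by decide

/-- A basis of `𝔽₁₁²` in which two elements of the binary icosahedral group have the matrices
`genA` and `genB` has square determinant. -/
theorem area_pow_five {x y : SL} (hx : x ∈ icosahedral)
    (hy : y ∈ icosahedral) {v w : V} (hvw : area v w ≠ 0)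
    (hxv : toLin' x v = (3 : ZMod 11) • v) (hxw : toLin' x w = (4 : ZMod 11) • w)
    (hyv : toLin' y v = (5 : ZMod 11) • v + (9 : ZMod 11) • w)
    (hyw : toLin' y w = v + (2 : ZMod 11) • w) : area v w ^ 5 = 1 := by
  have hp : Fact (Nat.Prime 11) := ⟨by norm_num⟩
  have hv : v ≠ 0 := by
    rintro rfl
    exact hvw (by simp [area])
  have hcol := area_column hv
  have hxc : toLin' x (column v) = (4 : ZMod 11) • column v := by
    rw [← column_toLin' hx, hxv, column_three_smul]
  have hwc : area w (column v) = 0 := by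
    have h := area_toLin' x w (column v)
    rw [hxw, hxc] at h
    have h15 : (15 : ZMod 11) * area w (column v) = 0 := by
      simp only [area, Pi.smul_apply, smul_eq_mul] at h ⊢
      linear_combination h
    exact (mul_eq_zero.1 h15).resolve_left fifteen_ne_zero
  have hw : w = area v w • column v := by
    simp only [area] at hcol hwc ⊢
    funext i
    fin_cases i
    · simp only [Fin.zero_eta, Fin.isValue, Pi.smul_apply, smul_eq_mul]
      linear_combination (-w 0) * hcol + (v 0) * hwc
    · simp only [Fin.mk_one, Fin.isValue, Pi.smul_apply, smul_eq_mul]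
      linear_combination (-w 1) * hcol + (v 1) * hwc
  refine pow_five_eq_one_of_column hv hvw ?_
  have hyv' : toLin' y v = (5 : ZMod 11) • v + (9 * area v w) • column v := by
    rw [hyv, mul_smul, ← hw]
  rw [← hyv', column_toLin' hy, ← map_smul, ← hw, hyw, mul_smul, ← hw]

theorem genA_mem : genA ∈ icosahedral := Subgroup.subset_closure (by simp)

theorem genB_mem : genB ∈ icosahedral := Subgroup.subset_closure (by simp)

theorem card_icosahedral_le : Nat.card icosahedral ≤ 121 := by
  have hinj : Function.Injective fun g : icosahedral => toLin' g.1 ![1, 0] := by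
    intro g h hgh
    have hcol : column ![1, 0] = ![0, 1] := by decide
    have hgh' : toLin' g.1 ![0, 1] = toLin' h.1 ![0, 1] := by
      have := congrArg column hgh
      simpa only [column_toLin' g.2, column_toLin' h.2, hcol] using this
    ext i j
    have h0 := congrFun hgh i
    have h1 := congrFun hgh' i
    fin_cases j
    · simpa [Matrix.SpecialLinearGroup.toLin'_apply, Matrix.mulVec, dotProduct] using h0
    · simpa [Matrix.SpecialLinearGroup.toLin'_apply, Matrix.mulVec, dotProduct] using h1
  calc Nat.card icosahedral ≤ Nat.card V :=
        Nat.card_le_card_of_injective _ hinj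
    _ = 121 := by simp

theorem neg_one_mem : (-1 : SL) ∈ icosahedral := by
  have h : (-1 : SL) = (genA * genA * genB) ^ 2 := by
    decide +kernel
  rw [h]
  exact pow_mem (mul_mem (mul_mem genA_mem genA_mem) genB_mem) 2

theorem thirty_dvd_card_icosahedral : 30 ∣ Nat.card icosahedral := by
  let a : icosahedral := ⟨genA, genA_mem⟩
  let b : icosahedral := ⟨genB, genB_mem⟩
  have h2 : 2 ∣ Nat.card icosahedral := by
    have : orderOf ((a * a * b) ^ 2) = 2 :=
      have := Fact.mk Nat.prime_two
      orderOf_eq_prime (by decide +kernel) (by decide +kernel)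
    exact (dvd_of_eq this.symm).trans (orderOf_dvd_natCard _)
  have h3 : 3 ∣ Nat.card icosahedral := by
    have : orderOf (a⁻¹ * a⁻¹ * b) = 3 :=
      have := Fact.mk Nat.prime_three
      orderOf_eq_prime (by decide +kernel) (by decide +kernel)
    exact (dvd_of_eq this.symm).trans (orderOf_dvd_natCard _)
  have h5 : 5 ∣ Nat.card icosahedral := by
    have : orderOf a = 5 :=
      have := Fact.mk Nat.prime_five
      orderOf_eq_prime (by decide +kernel) (by decide +kernel)
    exact (dvd_of_eq this.symm).trans (orderOf_dvd_natCard _)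
  omega

theorem card_icosahedral_pos : 0 < Nat.card icosahedral := Nat.card_pos

theorem eq_one_of_pow_eleven {g : icosahedral} (hg : g ^ 11 = 1) : g = 1 := by
  have hp : Fact (Nat.Prime 11) := ⟨by norm_num⟩
  by_contra hne
  have h11 : 11 ∣ Nat.card icosahedral :=
    (dvd_of_eq (orderOf_eq_prime hg hne).symm).trans (orderOf_dvd_natCard g)
  have := thirty_dvd_card_icosahedral
  have := card_icosahedral_le
  have := card_icosahedral_pos
  omega

theorem normalClosure_genA :
    Subgroup.normalClosure {(⟨genA, genA_mem⟩ : icosahedral)} = ⊤ := by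
  set a : icosahedral := ⟨genA, genA_mem⟩
  set b : icosahedral := ⟨genB, genB_mem⟩
  have hb : b = (a⁻¹ * b⁻¹) * a * (a⁻¹ * b⁻¹)⁻¹ := by decide +kernel
  have ha_mem : a ∈ Subgroup.normalClosure {a} :=
    Subgroup.subset_normalClosure (Set.mem_singleton a)
  have hb_mem : b ∈ Subgroup.normalClosure {a} := by
    rw [hb]
    exact Subgroup.normalClosure_normal.conj_mem _ ha_mem _
  refine top_le_iff.1 ((Subgroup.closure_closure_coe_preimage (k := {genA, genB})).ge.trans ?_)
  refine (Subgroup.closure_le _).2 ?_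
  rintro ⟨x, hx'⟩ hx
  rcases hx with rfl | rfl
  · exact ha_mem
  · exact hb_mem

theorem commutator_icosahedral : commutator icosahedral = ⊤ := by
  rw [eq_top_iff, ← normalClosure_genA]
  refine Subgroup.normalClosure_le_normal (Set.singleton_subset_iff.2 ?_)
  set a : icosahedral := ⟨genA, genA_mem⟩
  set b : icosahedral := ⟨genB, genB_mem⟩
  have ha : a = ⁅a⁻¹ * a⁻¹, b⁻¹ * b⁻¹ * a * b⁻¹⁆ := by decide +kernel
  rw [ha]
  exact Subgroup.commutator_mem_commutator (Subgroup.mem_top _) (Subgroup.mem_top _)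

theorem normalJoinIrreducible_icosahedral : NormalJoinIrreducible icosahedral := by
  refine .of_prime_order Nat.prime_five ⟨genA, genA_mem⟩ (by decide +kernel) normalClosure_genA ?_
  have := thirty_dvd_card_icosahedral
  have := card_icosahedral_le
  have := card_icosahedral_pos
  omega

end BinaryIcosahedral

section AffineGroup

open scoped commutatorElement

/-- The action of the binary icosahedral group on `𝔽₁₁²`. -/
def act : icosahedral →* (V ≃ₗ[ZMod 11] V) :=
  Matrix.SpecialLinearGroup.toLin'.comp icosahedral.subtype

theorem area_act (g : icosahedral) (v w : V) : area (act g v) (act g w) = area v w :=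
  area_toLin' g v w

/-- The central element `-1` of the binary icosahedral group. -/
def negOne : icosahedral := ⟨-1, neg_one_mem⟩

theorem act_negOne (v : V) : act negOne v = -v := by
  change Matrix.SpecialLinearGroup.toLin' (-1 : SL) v = -v
  rw [Matrix.SpecialLinearGroup.toLin'_apply]
  simp

theorem negOne_ne_one : negOne ≠ 1 := by decide +kernel

/-- The semidirect product of `m + 1` copies of `𝔽₁₁²` with the binary icosahedral group. -/
@[ext]
structure AffineGroup (m : ℕ) where
  vec : Fin (m + 1) → V
  lin : icosahedral

namespace AffineGroup

variable {m m' : ℕ}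

instance : Mul (AffineGroup m) :=
  ⟨fun x y => ⟨fun i => x.vec i + act x.lin (y.vec i), x.lin * y.lin⟩⟩

instance : One (AffineGroup m) := ⟨⟨0, 1⟩⟩

instance : Inv (AffineGroup m) := ⟨fun x => ⟨fun i => -act x.lin⁻¹ (x.vec i), x.lin⁻¹⟩⟩

@[simp] theorem vec_mul (x y : AffineGroup m) (i : Fin (m + 1)) :
    (x * y).vec i = x.vec i + act x.lin (y.vec i) := rfl

@[simp] theorem lin_mul (x y : AffineGroup m) : (x * y).lin = x.lin * y.lin := rfl

@[simp] theorem vec_one (i : Fin (m + 1)) : (1 : AffineGroup m).vec i = 0 := rfl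

@[simp] theorem lin_one : (1 : AffineGroup m).lin = 1 := rfl

@[simp] theorem vec_inv (x : AffineGroup m) (i : Fin (m + 1)) :
    x⁻¹.vec i = -act x.lin⁻¹ (x.vec i) := rfl

@[simp] theorem lin_inv (x : AffineGroup m) : x⁻¹.lin = x.lin⁻¹ := rfl

theorem ext_vec {x y : AffineGroup m} (h : ∀ i, x.vec i = y.vec i) (h' : x.lin = y.lin) : x = y :=
  AffineGroup.ext (funext h) h'

instance : Group (AffineGroup m) :=
  Group.ofLeftAxioms
    (fun x y z => ext_vec (fun i => by simp [add_assoc]) (mul_assoc _ _ _))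
    (fun x => ext_vec (fun i => by simp) (one_mul _))
    (fun x => ext_vec (fun i => by simp) (inv_mul_cancel _))

/-- The underlying set of `AffineGroup m` as a product. -/
def equivProd (m : ℕ) : AffineGroup m ≃ (Fin (m + 1) → V) × icosahedral where
  toFun x := (x.vec, x.lin)
  invFun p := ⟨p.1, p.2⟩

instance : Finite (AffineGroup m) := Finite.of_equiv _ (equivProd m).symm

theorem card_eq (m : ℕ) : Nat.card (AffineGroup m) = 121 ^ (m + 1) * Nat.card icosahedral := by
  rw [Nat.card_congr (equivProd m), Nat.card_prod]
  simp

/-- The projection to the binary icosahedral group. -/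
def linHom (m : ℕ) : AffineGroup m →* icosahedral where
  toFun := lin
  map_one' := rfl
  map_mul' _ _ := rfl

theorem linHom_surjective : Function.Surjective (linHom m) := fun g => ⟨⟨0, g⟩, rfl⟩

/-- The vectors as elements of the affine group. -/
def ofVec (v : Fin (m + 1) → V) : AffineGroup m := ⟨v, 1⟩

/-- The linear elements of the affine group. -/
def ofLin (g : icosahedral) : AffineGroup m := ⟨0, g⟩

theorem ofVec_mul (v w : Fin (m + 1) → V) : ofVec v * ofVec w = ofVec (v + w) :=
  ext_vec (fun i => by simp [ofVec]) (mul_one _)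

theorem eq_ofVec {x : AffineGroup m} (h : x.lin = 1) : x = ofVec x.vec :=
  AffineGroup.ext rfl h

theorem ofLin_mul_ofVec (g : icosahedral) (v : Fin (m + 1) → V) :
    ofLin g * ofVec v = ofVec (fun i => act g (v i)) * ofLin g :=
  ext_vec (fun i => by simp [ofVec, ofLin]) (by simp [ofVec, ofLin])

theorem ofVec_pow (v : Fin (m + 1) → V) (n : ℕ) : ofVec v ^ n = ofVec (n • v) := by
  induction n with
  | zero => rw [pow_zero, zero_smul]; rfl
  | succ n ih => rw [pow_succ, ih, ofVec_mul, succ_nsmul]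

theorem ofVec_pow_eleven (v : Fin (m + 1) → V) : ofVec v ^ 11 = 1 := by
  have h : (11 : ℕ) • v = 0 := by
    funext i j
    rw [Pi.smul_apply, Pi.smul_apply, nsmul_eq_mul, show ((11 : ℕ) : ZMod 11) = 0 from by decide,
      zero_mul]
    rfl
  rw [ofVec_pow, h]
  rfl

theorem comm_of_mem_ker : ∀ x ∈ (linHom m).ker, ∀ y ∈ (linHom m).ker, x * y = y * x := by
  intro x hx y hy
  rw [eq_ofVec hx, eq_ofVec hy, ofVec_mul, ofVec_mul, add_comm]

theorem ofVec_eq_commutator (v : Fin (m + 1) → V) :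
    ofVec v = ⁅ofVec ((6 : ZMod 11) • v), ofLin negOne⁆ := by
  rw [commutatorElement_def, eq_mul_inv_iff_mul_eq, eq_mul_inv_iff_mul_eq, mul_assoc,
    ofLin_mul_ofVec, ← mul_assoc, ofVec_mul]
  congr 2
  funext i
  rw [Pi.add_apply, act_negOne, Pi.smul_apply, add_neg_eq_iff_eq_add, ← add_smul,
    show (6 + 6 : ZMod 11) = 1 from by decide, one_smul]

theorem commutator_eq_top : commutator (AffineGroup m) = ⊤ := by
  refine commutator_eq_top_of_surjective (linHom m) linHom_surjective commutator_icosahedral ?_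
  intro x hx
  rw [eq_ofVec hx, ofVec_eq_commutator]
  exact Subgroup.commutator_mem_commutator (Subgroup.mem_top _) (Subgroup.mem_top _)

theorem normalJoinIrreducible : NormalJoinIrreducible (AffineGroup m) :=
  normalJoinIrreducible_icosahedral.of_surjective commutator_eq_top (linHom m) linHom_surjective
    comm_of_mem_ker

/-- The diagonal translation by a vector. -/
def diag (v : V) : AffineGroup m := ofVec fun _ => v

theorem diag_add (v w : V) : (diag (v + w) : AffineGroup m) = diag v * diag w :=
  (ofVec_mul _ _).symm

theorem ofLin_mul_diag (g : icosahedral) (v : V) :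
    (ofLin g * diag v : AffineGroup m) = diag (act g v) * ofLin g :=
  ofLin_mul_ofVec g _

variable (χ : AffineGroup m →* AffineGroup m')

theorem lin_map_diag (v : V) : (χ (diag v)).lin = 1 := by
  refine eq_one_of_pow_eleven (g := linHom m' (χ (diag v))) ?_
  rw [← map_pow, ← map_pow, diag, ofVec_pow_eleven, map_one, map_one]

/-- A homomorphism of affine groups induces an additive map of the vectors. -/
def vecHom : V →+ V where
  toFun v := (χ (diag v)).vec 0
  map_zero' := by
    rw [show diag 0 = (1 : AffineGroup m) from rfl, map_one]
    rfl
  map_add' v w := by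
    rw [diag_add, map_mul, vec_mul, lin_map_diag, map_one]
    rfl

theorem act_vecHom (g : icosahedral) (v : V) :
    act (χ (ofLin g)).lin (vecHom χ v) = vecHom χ (act g v) := by
  have h := congrArg (fun x => (χ x).vec 0) (ofLin_mul_diag (m := m) g v)
  simp only [map_mul, vec_mul, lin_map_diag, map_one, LinearEquiv.coe_one, id_eq] at h
  rw [add_comm] at h
  exact add_right_cancel h

theorem area_vecHom_pow_five (h : area (vecHom χ ![1, 0]) (vecHom χ ![0, 1]) ≠ 0) :
    area (vecHom χ ![1, 0]) (vecHom χ ![0, 1]) ^ 5 = 1 := by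
  have hA := act_vecHom χ ⟨genA, genA_mem⟩
  have hB := act_vecHom χ ⟨genB, genB_mem⟩
  refine area_pow_five (χ (ofLin ⟨genA, genA_mem⟩)).lin.2 (χ (ofLin ⟨genB, genB_mem⟩)).lin.2 h
    ((hA _).trans ?_) ((hA _).trans ?_) ((hB _).trans ?_) ((hB _).trans ?_)
  · rw [show act ⟨genA, genA_mem⟩ ![1, 0] = (3 : ZMod 11) • ![1, 0] from by decide +kernel,
      ZMod.map_smul]
  · rw [show act ⟨genA, genA_mem⟩ ![0, 1] = (4 : ZMod 11) • ![0, 1] from by decide +kernel,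
      ZMod.map_smul]
  · rw [show act ⟨genB, genB_mem⟩ ![1, 0] = (5 : ZMod 11) • ![1, 0] + (9 : ZMod 11) • ![0, 1]
      from by decide +kernel, map_add, ZMod.map_smul, ZMod.map_smul]
  · rw [show act ⟨genB, genB_mem⟩ ![0, 1] = ![1, 0] + (2 : ZMod 11) • ![0, 1]
      from by decide +kernel, map_add, ZMod.map_smul]

/-- The cocycle defining a central extension of the affine group by `𝔽₁₁`. -/
def cocycle (x y : AffineGroup m) : ZMod 11 := area (x.vec 0) (act x.lin (y.vec 0))

theorem area_add_left (u v w : V) : area (u + v) w = area u w + area v w := by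
  simp only [area, Pi.add_apply]; ring

theorem area_add_right (u v w : V) : area u (v + w) = area u v + area u w := by
  simp only [area, Pi.add_apply]; ring

@[simp] theorem cocycle_one_left (x : AffineGroup m) : cocycle 1 x = 0 := by
  simp [cocycle, area]

@[simp] theorem cocycle_one_right (x : AffineGroup m) : cocycle x 1 = 0 := by
  simp [cocycle, area]

theorem cocycle_mul (x y z : AffineGroup m) :
    cocycle x y + cocycle (x * y) z = cocycle y z + cocycle x (y * z) := by
  simp only [cocycle, vec_mul, lin_mul, map_mul, LinearEquiv.mul_apply, map_add, area_add_left,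
    area_add_right, area_act]
  ring

theorem cocycle_inv_self (x : AffineGroup m) : cocycle x⁻¹ x = 0 := by
  simp only [cocycle, vec_inv, lin_inv, area, Pi.neg_apply]
  ring

theorem cocycle_inv_inv (x y : AffineGroup m) : cocycle x⁻¹ y⁻¹ = -cocycle y x := by
  have h : cocycle x⁻¹ y⁻¹ = area (x.vec 0) (act y.lin⁻¹ (y.vec 0)) := by
    rw [cocycle, vec_inv, vec_inv, lin_inv, map_neg, ← area_act x.lin⁻¹ (x.vec 0)]
    simp only [area, Pi.neg_apply]
    ring
  rw [h, cocycle, ← area_act y.lin, ← LinearEquiv.mul_apply, ← map_mul, mul_inv_cancel, map_one]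
  simp only [area, LinearEquiv.coe_one, id_eq]
  ring

theorem cocycle_of_lin_eq_one {x : AffineGroup m} (hx : x.lin = 1) (y : AffineGroup m) :
    cocycle x y = area (x.vec 0) (y.vec 0) := by
  rw [cocycle, hx, map_one]
  rfl

end AffineGroup
end AffineGroup

section CentralProduct

open scoped commutatorElement
open AffineGroup

/-- The three factors are built from `1`, `1` and `2` copies of the plane. -/
def rank : Fin 3 → ℕ
  | 0 => 0
  | 1 => 0
  | 2 => 1

/-- The central product of three central extensions of affine groups by `𝔽₁₁`, with the classes
scaled by the coefficients `ε`. -/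
@[ext]
structure CentralProduct (ε : Fin 3 → ZMod 11) where
  coord : ∀ i, AffineGroup (rank i)
  phase : ZMod 11

namespace CentralProduct

variable {ε : Fin 3 → ZMod 11}

/-- The sum of the scaled cocycles of the factors. -/
def totalCocycle (ε : Fin 3 → ZMod 11) (x y : ∀ i, AffineGroup (rank i)) : ZMod 11 :=
  ∑ i, ε i * cocycle (x i) (y i)

instance : Mul (CentralProduct ε) :=
  ⟨fun x y => ⟨x.coord * y.coord, x.phase + y.phase + totalCocycle ε x.coord y.coord⟩⟩

instance : One (CentralProduct ε) := ⟨⟨1, 0⟩⟩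

instance : Inv (CentralProduct ε) := ⟨fun x => ⟨x.coord⁻¹, -x.phase⟩⟩

@[simp] theorem coord_mul (x y : CentralProduct ε) : (x * y).coord = x.coord * y.coord := rfl

theorem coord_mul_apply (x y : CentralProduct ε) (i : Fin 3) :
    (x * y).coord i = x.coord i * y.coord i := rfl

@[simp] theorem phase_mul (x y : CentralProduct ε) :
    (x * y).phase = x.phase + y.phase + totalCocycle ε x.coord y.coord := rfl

@[simp] theorem coord_one : (1 : CentralProduct ε).coord = 1 := rfl

@[simp] theorem phase_one : (1 : CentralProduct ε).phase = 0 := rfl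

@[simp] theorem coord_inv (x : CentralProduct ε) : x⁻¹.coord = x.coord⁻¹ := rfl

@[simp] theorem phase_inv (x : CentralProduct ε) : x⁻¹.phase = -x.phase := rfl

theorem totalCocycle_mul (x y z : ∀ i, AffineGroup (rank i)) :
    totalCocycle ε x y + totalCocycle ε (x * y) z =
      totalCocycle ε y z + totalCocycle ε x (y * z) := by
  simp only [totalCocycle, ← Finset.sum_add_distrib, ← mul_add, Pi.mul_apply, cocycle_mul]

@[simp] theorem totalCocycle_one_left (x : ∀ i, AffineGroup (rank i)) :
    totalCocycle ε 1 x = 0 := by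
  simp [totalCocycle]

@[simp] theorem totalCocycle_one_right (x : ∀ i, AffineGroup (rank i)) :
    totalCocycle ε x 1 = 0 := by
  simp [totalCocycle]

@[simp] theorem totalCocycle_inv_self (x : ∀ i, AffineGroup (rank i)) :
    totalCocycle ε x⁻¹ x = 0 := by
  simp [totalCocycle, cocycle_inv_self]

instance : Group (CentralProduct ε) :=
  Group.ofLeftAxioms
    (fun x y z => by
      refine CentralProduct.ext (mul_assoc _ _ _) ?_
      simp only [phase_mul, coord_mul]
      linear_combination totalCocycle_mul (ε := ε) x.coord y.coord z.coord)
    (fun x => CentralProduct.ext (one_mul _) (by simp))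
    (fun x => CentralProduct.ext (inv_mul_cancel _) (by simp))

/-- The underlying set of `CentralProduct ε` as a product. -/
def equivProd : CentralProduct ε ≃ (∀ i, AffineGroup (rank i)) × ZMod 11 where
  toFun x := (x.coord, x.phase)
  invFun p := ⟨p.1, p.2⟩

instance : Finite (CentralProduct ε) := Finite.of_equiv _ equivProd.symm

/-- The projection to the coordinate `i`. -/
def proj (i : Fin 3) : CentralProduct ε →* AffineGroup (rank i) where
  toFun x := x.coord i
  map_one' := rfl
  map_mul' _ _ := rfl

/-- The elements of the central copy of `𝔽₁₁`. -/
def ofPhase (ε : Fin 3 → ZMod 11) (c : ZMod 11) : CentralProduct ε := ⟨1, c⟩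

/-- The element with the only nontrivial coordinate `k` at `i` and the phase `0`. -/
def single (ε : Fin 3 → ZMod 11) (i : Fin 3) (k : AffineGroup (rank i)) : CentralProduct ε :=
  ⟨Pi.mulSingle i k, 0⟩

/-- The factor `i` of the central product. -/
def factor (ε : Fin 3 → ZMod 11) (i : Fin 3) : Subgroup (CentralProduct ε) where
  carrier := {x | ∀ j, j ≠ i → x.coord j = 1}
  mul_mem' hx hy j hj := by rw [coord_mul, Pi.mul_apply, hx j hj, hy j hj, one_mul]
  one_mem' _ _ := rfl
  inv_mem' hx j hj := by rw [coord_inv, Pi.inv_apply, hx j hj, inv_one]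

theorem mem_factor {i : Fin 3} {x : CentralProduct ε} :
    x ∈ factor ε i ↔ ∀ j, j ≠ i → x.coord j = 1 := Iff.rfl

theorem single_mem (i : Fin 3) (k : AffineGroup (rank i)) : single ε i k ∈ factor ε i :=
  fun _ hj => by simp [single, hj]

theorem ofPhase_mem (i : Fin 3) (c : ZMod 11) : ofPhase ε c ∈ factor ε i := fun _ _ => rfl

theorem totalCocycle_of_mem {i : Fin 3} {x : CentralProduct ε} (hx : x ∈ factor ε i)
    (y : CentralProduct ε) :
    totalCocycle ε x.coord y.coord = ε i * cocycle (x.coord i) (y.coord i) :=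
  Finset.sum_eq_single_of_mem i (Finset.mem_univ i) fun j _ hj => by
    rw [hx j hj, cocycle_one_left, mul_zero]

theorem eq_ofPhase {x : CentralProduct ε} (h : ∀ i, x.coord i = 1) : x = ofPhase ε x.phase :=
  CentralProduct.ext (funext h) rfl

theorem eq_single_mul {i : Fin 3} {x : CentralProduct ε} (hx : x ∈ factor ε i) :
    x = single ε i (x.coord i) * ofPhase ε x.phase := by
  refine CentralProduct.ext (funext fun j => ?_) (by simp [single, ofPhase])
  obtain rfl | hj := eq_or_ne j i
  · simp [single, ofPhase]
  · simp [single, ofPhase, hx j hj, hj]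

theorem ext_of_mem {i : Fin 3} {x y : CentralProduct ε} (hx : x ∈ factor ε i)
    (hy : y ∈ factor ε i) (h : x.coord i = y.coord i) (h' : x.phase = y.phase) : x = y := by
  rw [eq_single_mul hx, eq_single_mul hy, h, h']

theorem ofPhase_mul (c : ZMod 11) (x : CentralProduct ε) :
    ofPhase ε c * x = ⟨x.coord, c + x.phase⟩ :=
  CentralProduct.ext (one_mul _) (by simp [ofPhase])

theorem ofPhase_mul_ofPhase (c d : ZMod 11) :
    ofPhase ε c * ofPhase ε d = ofPhase ε (c + d) := ofPhase_mul _ _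

theorem ofPhase_pow (c : ZMod 11) (n : ℕ) : ofPhase ε c ^ n = ofPhase ε (n * c) := by
  induction n with
  | zero => rw [pow_zero, Nat.cast_zero, zero_mul]; rfl
  | succ n ih => rw [pow_succ, ih, ofPhase_mul_ofPhase, Nat.cast_succ, add_one_mul]

theorem commute_of_mem {i j : Fin 3} (hij : i ≠ j) {x y : CentralProduct ε}
    (hx : x ∈ factor ε i) (hy : y ∈ factor ε j) : x * y = y * x := by
  refine CentralProduct.ext (funext fun k => ?_) ?_
  · simp only [coord_mul, Pi.mul_apply]
    obtain rfl | hk := eq_or_ne k i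
    · rw [hy k hij, one_mul, mul_one]
    · rw [hx k hk, one_mul, mul_one]
  · rw [phase_mul, phase_mul, totalCocycle_of_mem hx, totalCocycle_of_mem hy, hx j hij.symm,
      hy i hij, cocycle_one_right, cocycle_one_right]
    ring

theorem exists_eq_mul (x : CentralProduct ε) :
    ∃ a ∈ factor ε 0, ∃ b ∈ factor ε 1, ∃ c ∈ factor ε 2, x = a * b * c := by
  refine ⟨_, single_mem 0 (x.coord 0), _, single_mem 1 (x.coord 1),
    single ε 2 (x.coord 2) * ofPhase ε x.phase, mul_mem (single_mem _ _) (ofPhase_mem _ _), ?_⟩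
  refine CentralProduct.ext (funext fun j => ?_) ?_
  · fin_cases j <;> simp [single, ofPhase]
  · simp [single, ofPhase, totalCocycle, Fin.sum_univ_three]

theorem factor_normal (i : Fin 3) : (factor ε i).Normal :=
  ⟨fun x hx y j hj => by simp [hx j hj]⟩

theorem factor_sup : factor ε 0 ⊔ factor ε 1 ⊔ factor ε 2 = ⊤ := by
  rw [eq_top_iff]
  intro x _
  obtain ⟨a, ha, b, hb, c, hc, rfl⟩ := exists_eq_mul x
  exact Subgroup.mul_mem_sup (Subgroup.mul_mem_sup ha hb) hc

theorem eq_of_factor_le {i j : Fin 3} (h : factor ε i ≤ factor ε j) : i = j := by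
  by_contra hij
  have := h (single_mem i (ofLin negOne)) i hij
  simp only [single, Pi.mulSingle_eq_same] at this
  exact negOne_ne_one (congrArg lin this)

/-- The projection of a factor to its coordinate. -/
def factorHom (ε : Fin 3 → ZMod 11) (i : Fin 3) : factor ε i →* AffineGroup (rank i) :=
  (proj i).comp (factor ε i).subtype

theorem factorHom_surjective (i : Fin 3) : Function.Surjective (factorHom ε i) :=
  fun k => ⟨⟨_, single_mem i k⟩, by simp [factorHom, proj, single]⟩

theorem eq_ofPhase_of_mem_ker {i : Fin 3} {x : factor ε i} (hx : x ∈ (factorHom ε i).ker) :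
    x.1 = ofPhase ε x.1.phase := by
  refine eq_ofPhase fun j => ?_
  obtain rfl | hj := eq_or_ne j i
  · exact hx
  · exact x.2 j hj

theorem mul_eq_of_lin_eq_one {i : Fin 3} {x y : CentralProduct ε} (hx : x ∈ factor ε i)
    (hy : y ∈ factor ε i) (hx' : (x.coord i).lin = 1) (hy' : (y.coord i).lin = 1) :
    x * y = ofPhase ε (2 * (ε i * area ((x.coord i).vec 0) ((y.coord i).vec 0))) * (y * x) := by
  rw [ofPhase_mul]
  refine ext_of_mem (mul_mem hx hy) ?_ ?_ ?_
  · exact mul_mem hy hx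
  · exact comm_of_mem_ker _ hx' _ hy'
  · simp only [phase_mul]
    rw [totalCocycle_of_mem hx, totalCocycle_of_mem hy, cocycle_of_lin_eq_one hx',
      cocycle_of_lin_eq_one hy']
    simp only [area]
    ring

theorem single_diag_mul (i : Fin 3) (v w : V) :
    single ε i (diag v) * single ε i (diag w) =
      ofPhase ε (2 * (ε i * area v w)) * (single ε i (diag w) * single ε i (diag v)) := by
  have h := mul_eq_of_lin_eq_one (single_mem (ε := ε) i (diag v)) (single_mem i (diag w))
  simp only [single, Pi.mulSingle_eq_same] at h
  exact h rfl rfl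

theorem two_ne_zero_zmod_eleven : (2 : ZMod 11) ≠ 0 := by decide

theorem commutator_factor_eq_top {i : Fin 3} (hi : ε i ≠ 0) : commutator (factor ε i) = ⊤ := by
  have hp : Fact (Nat.Prime 11) := ⟨by norm_num⟩
  refine commutator_eq_top_of_surjective (factorHom ε i) (factorHom_surjective i)
    commutator_eq_top ?_
  intro x hx
  let v : V := ![x.1.phase / (2 * ε i), 0]
  let w : V := ![0, 1]
  have hvw : 2 * (ε i * area v w) = x.1.phase := by
    have h2 := two_ne_zero_zmod_eleven
    simp only [area, v, w, Matrix.cons_val_zero, Matrix.cons_val_one]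
    field_simp
    ring
  have h := single_diag_mul (ε := ε) i v w
  rw [hvw, ← eq_ofPhase_of_mem_ker hx] at h
  have hx' : x = ⁅(⟨_, single_mem i (diag v)⟩ : factor ε i), ⟨_, single_mem i (diag w)⟩⁆ := by
    rw [commutatorElement_def, eq_mul_inv_iff_mul_eq, eq_mul_inv_iff_mul_eq, mul_assoc]
    exact Subtype.ext h.symm
  rw [hx']
  exact Subgroup.commutator_mem_commutator (Subgroup.mem_top _) (Subgroup.mem_top _)

theorem commutator_factor {i : Fin 3} (hi : ε i ≠ 0) : ⁅factor ε i, factor ε i⁆ = factor ε i := by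
  have h := congrArg (Subgroup.map (factor ε i).subtype) (commutator_factor_eq_top hi)
  rwa [commutator_def, Subgroup.map_commutator, ← MonoidHom.range_eq_map,
    Subgroup.range_subtype] at h

theorem normalJoinIrreducible_factor {i : Fin 3} (hi : ε i ≠ 0) :
    NormalJoinIrreducible (factor ε i) := by
  refine normalJoinIrreducible.of_surjective (commutator_factor_eq_top hi) (factorHom ε i)
    (factorHom_surjective i) fun x hx y hy => Subtype.ext ?_
  rw [Subgroup.coe_mul, Subgroup.coe_mul, eq_ofPhase_of_mem_ker hx, eq_ofPhase_of_mem_ker hy,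
    ofPhase_mul_ofPhase, ofPhase_mul_ofPhase, add_comm]

theorem card_factor (i : Fin 3) :
    Nat.card (factor ε i) = 121 ^ (rank i + 1) * Nat.card icosahedral * 11 := by
  let e : factor ε i ≃ AffineGroup (rank i) × ZMod 11 :=
    { toFun x := (x.1.coord i, x.1.phase)
      invFun p := ⟨single ε i p.1 * ofPhase ε p.2, mul_mem (single_mem _ _) (ofPhase_mem _ _)⟩
      left_inv x := Subtype.ext (eq_single_mul x.2).symm
      right_inv p := by simp [single, ofPhase] }
  rw [Nat.card_congr e, Nat.card_prod, AffineGroup.card_eq, Nat.card_zmod]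

theorem exists_map_factor_eq (hε : ∀ i, ε i ≠ 0) (θ : CentralProduct ε ≃* CentralProduct ε)
    (i : Fin 3) : ∃ j, (factor ε i).map θ.toMonoidHom = factor ε j := by
  have key : ∀ (θ : CentralProduct ε ≃* CentralProduct ε) (i : Fin 3),
      ∃ j, (factor ε i).map θ.toMonoidHom ≤ factor ε j := by
    intro θ i
    refine le_of_normalJoinIrreducible (factor ε) factor_normal factor_sup _
      ((factor_normal i).map _ θ.surjective) ?_ ?_
    · rw [← Subgroup.map_commutator, commutator_factor (hε i)]
    · exact (normalJoinIrreducible_factor (hε i)).of_mulEquiv (θ.subgroupMap _)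
  obtain ⟨j, hj⟩ := key θ i
  obtain ⟨k, hk⟩ := key θ.symm j
  have hik : factor ε i ≤ factor ε k := by
    intro x hx
    simpa using hk (Subgroup.mem_map_of_mem _ (hj (Subgroup.mem_map_of_mem _ hx)))
  obtain rfl := eq_of_factor_le hik
  refine ⟨j, le_antisymm hj fun x hx => ⟨θ.symm x, ?_, θ.apply_symm_apply x⟩⟩
  exact hk (Subgroup.mem_map_of_mem _ hx)

/-- An automorphism mapping a factor to another one acts on the centre by a scalar whose fifth
power is the quotient of the fifth powers of the coefficients. -/
theorem phase_pow_five (hε : ∀ i, ε i ≠ 0) (θ : CentralProduct ε ≃* CentralProduct ε)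
    {c : ZMod 11} (hc : θ (ofPhase ε 1) = ofPhase ε c) {i j : Fin 3}
    (hij : (factor ε i).map θ.toMonoidHom = factor ε j) : (ε i * c) ^ 5 = ε j ^ 5 := by
  have hp : Fact (Nat.Prime 11) := ⟨by norm_num⟩
  have hphase : ∀ d, θ (ofPhase ε d) = ofPhase ε (d * c) := by
    intro d
    have h := ofPhase_pow (ε := ε) 1 d.val
    rw [ZMod.natCast_val, ZMod.cast_id, mul_one] at h
    rw [← h, map_pow, hc, ofPhase_pow, ZMod.natCast_val, ZMod.cast_id]
  have hmem : ∀ k, θ (single ε i k) ∈ factor ε j := fun k =>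
    hij ▸ Subgroup.mem_map_of_mem _ (single_mem i k)
  let χ : AffineGroup (rank i) →* AffineGroup (rank j) := MonoidHom.mk'
    (fun k => (θ (single ε i k)).coord j) fun k l => by
      have h : single ε i k * single ε i l =
          single ε i (k * l) * ofPhase ε (single ε i k * single ε i l).phase := by
        convert eq_single_mul (mul_mem (single_mem i k) (single_mem i l)) using 3
        simp [single]
      have h' := congrArg (fun x => (θ x).coord j) h
      simp only [map_mul, hphase, coord_mul, Pi.mul_apply] at h'
      rw [h']
      exact (mul_one _).symm
  have hc0 : c ≠ 0 := by
    rintro rfl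
    have : ofPhase ε 1 = 1 := θ.injective (hc.trans (map_one θ).symm)
    exact one_ne_zero (congrArg phase this)
  have harea : 2 * (ε i * area ![1, 0] ![0, 1]) * c =
      2 * (ε j * area (vecHom χ ![1, 0]) (vecHom χ ![0, 1])) := by
    have h := congrArg θ (single_diag_mul (ε := ε) i ![1, 0] ![0, 1])
    rw [map_mul, map_mul, map_mul, hphase, mul_eq_of_lin_eq_one (hmem _) (hmem _)
      (lin_map_diag χ _) (lin_map_diag χ _)] at h
    exact (congrArg phase (mul_right_cancel h)).symm
  have h1 : ε i * c = ε j * area (vecHom χ ![1, 0]) (vecHom χ ![0, 1]) := by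
    rw [show area ![1, 0] ![0, 1] = 1 from by simp [area]] at harea
    exact mul_left_cancel₀ two_ne_zero_zmod_eleven (by linear_combination harea)
  have h0 : area (vecHom χ ![1, 0]) (vecHom χ ![0, 1]) ≠ 0 := by
    intro h
    rw [h, mul_zero] at h1
    exact mul_ne_zero (hε i) hc0 h1
  rw [h1, mul_pow, area_vecHom_pow_five χ h0, mul_one]

theorem exists_map_ofPhase (hε : ∀ i, ε i ≠ 0) (θ : CentralProduct ε ≃* CentralProduct ε) :
    ∃ c, θ (ofPhase ε 1) = ofPhase ε c := by
  choose π hπ using exists_map_factor_eq hε θ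
  have hmem : ∀ i, θ (ofPhase ε 1) ∈ factor ε (π i) := fun i =>
    hπ i ▸ Subgroup.mem_map_of_mem _ (ofPhase_mem i 1)
  have hne : π 0 ≠ π 1 := by
    intro h
    have h' : factor ε 0 = factor ε 1 :=
      Subgroup.map_injective (f := θ.toMonoidHom) θ.injective (by rw [hπ, hπ, h])
    exact absurd (eq_of_factor_le h'.le) (by decide)
  refine ⟨_, eq_ofPhase fun j => ?_⟩
  obtain rfl | hj := eq_or_ne j (π 0)
  · exact hmem 1 _ hne
  · exact hmem 0 _ hj

theorem map_factor_two (hε : ∀ i, ε i ≠ 0) (θ : CentralProduct ε ≃* CentralProduct ε) :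
    (factor ε 2).map θ.toMonoidHom = factor ε 2 := by
  obtain ⟨j, hj⟩ := exists_map_factor_eq hε θ 2
  have hcard : Nat.card (factor ε 2) = Nat.card (factor ε j) := by
    rw [← hj]
    exact Nat.card_congr (θ.subgroupMap _).toEquiv
  rw [card_factor, card_factor] at hcard
  have := card_icosahedral_pos
  fin_cases j
  · simp only [rank] at hcard; omega
  · simp only [rank] at hcard; omega
  · exact hj

theorem factor_characteristic (hε : ∀ i, ε i ≠ 0) (hne : ε 0 ^ 5 ≠ ε 1 ^ 5) (i : Fin 3) :
    (factor ε i).Characteristic := by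
  refine Subgroup.characteristic_iff_map_eq.2 fun θ => ?_
  have h2 := map_factor_two hε θ
  obtain ⟨c, hc⟩ := exists_map_ofPhase hε θ
  have hp : Fact (Nat.Prime 11) := ⟨by norm_num⟩
  have hc5 : c ^ 5 = 1 := by
    have h := phase_pow_five hε θ hc h2
    rw [mul_pow] at h
    exact mul_left_cancel₀ (pow_ne_zero 5 (hε 2)) (h.trans (mul_one _).symm)
  obtain ⟨j, hj⟩ := exists_map_factor_eq hε θ i
  have h5 : ε i ^ 5 = ε j ^ 5 := by
    rw [← phase_pow_five hε θ hc hj, mul_pow, hc5, mul_one]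
  suffices i = j by rw [hj, this]
  by_cases hj2 : j = 2
  · subst hj2
    have h' : factor ε i = factor ε 2 :=
      Subgroup.map_injective (f := θ.toMonoidHom) θ.injective (hj.trans h2.symm)
    exact eq_of_factor_le h'.le
  by_cases hi2 : i = 2
  · subst hi2
    exact eq_of_factor_le (h2.symm.trans hj).le
  fin_cases i <;> fin_cases j
  all_goals first
    | rfl
    | exact absurd rfl hi2
    | exact absurd rfl hj2
    | exact absurd h5 hne
    | exact absurd h5 hne.symm

end CentralProduct
end CentralProduct

section Opposite

open CentralProduct AffineGroup

/-- Inverting the coordinate `0`. -/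
def invCoord (x : ∀ i, AffineGroup (rank i)) (i : Fin 3) : AffineGroup (rank i) :=
  if i = 0 then (x i)⁻¹ else x i

theorem invCoord_invCoord (x : ∀ i, AffineGroup (rank i)) : invCoord (invCoord x) = x := by
  funext i
  simp only [invCoord]
  split <;> simp

/-- The coefficients of the group `G`. -/
def coeff : Fin 3 → ZMod 11 := ![1, -1, 1]

/-- The coefficients after replacing the factor `0` by its opposite. -/
def coeffOp : Fin 3 → ZMod 11 := ![-1, -1, 1]

/-- Inverting the coordinate `0` identifies the underlying sets of the two central products. -/
def invEquiv : CentralProduct coeff ≃ CentralProduct coeffOp where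
  toFun x := ⟨invCoord x.coord, x.phase⟩
  invFun x := ⟨invCoord x.coord, x.phase⟩
  left_inv _ := CentralProduct.ext (invCoord_invCoord _) rfl
  right_inv _ := CentralProduct.ext (invCoord_invCoord _) rfl

theorem coord_invEquiv (x : CentralProduct coeff) : (invEquiv x).coord = invCoord x.coord := rfl

theorem phase_invEquiv (x : CentralProduct coeff) : (invEquiv x).phase = x.phase := rfl

theorem invEquiv_one : invEquiv 1 = 1 := by
  refine CentralProduct.ext (funext fun i => ?_) rfl
  simp [invEquiv, invCoord]

/-- The multiplication obtained by replacing the factor `0` by its opposite. -/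
def mulOp (x y : CentralProduct coeff) : CentralProduct coeff :=
  invEquiv.symm (invEquiv x * invEquiv y)

theorem invEquiv_mulOp (x y : CentralProduct coeff) :
    invEquiv (mulOp x y) = invEquiv x * invEquiv y :=
  invEquiv.apply_symm_apply _

theorem mulOp_mul {a a' b b' c c' : CentralProduct coeff} (ha : a ∈ factor coeff 0)
    (hb : b ∈ factor coeff 1) (hc : c ∈ factor coeff 2) (ha' : a' ∈ factor coeff 0)
    (hb' : b' ∈ factor coeff 1) (hc' : c' ∈ factor coeff 2) :
    mulOp (a * b * c) (a' * b' * c') = a' * a * (b * b') * (c * c') := by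
  rw [mem_factor] at ha hb hc ha' hb' hc'
  refine invEquiv.injective ?_
  rw [invEquiv_mulOp]
  refine CentralProduct.ext (funext fun i => ?_) ?_
  · fin_cases i <;> simp [invEquiv, invCoord, ha, hb, hc, ha', hb', hc']
  · simp only [phase_mul, phase_invEquiv, coord_invEquiv, totalCocycle, Fin.sum_univ_three,
      invCoord, coord_mul_apply]
    simp [coeff, coeffOp, cocycle_inv_inv, -mul_inv_rev,
      ha, hb, hc, ha', hb', hc']
    ring

/-- Exchanging the coordinates `0` and `1`. -/
def swapCoord (x : ∀ i, AffineGroup (rank i)) : ∀ i, AffineGroup (rank i)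
  | 0 => x 1
  | 1 => x 0
  | 2 => x 2

theorem swapCoord_swapCoord (x : ∀ i, AffineGroup (rank i)) : swapCoord (swapCoord x) = x := by
  funext i
  fin_cases i <;> rfl

/-- Exchanging the factors `0` and `1` is an automorphism when their coefficients agree. -/
def swapEquiv : CentralProduct coeffOp ≃* CentralProduct coeffOp where
  toFun x := ⟨swapCoord x.coord, x.phase⟩
  invFun x := ⟨swapCoord x.coord, x.phase⟩
  left_inv _ := CentralProduct.ext (swapCoord_swapCoord _) rfl
  right_inv _ := CentralProduct.ext (swapCoord_swapCoord _) rfl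
  map_mul' x y := by
    refine CentralProduct.ext (funext fun i => ?_) ?_
    · fin_cases i <;> rfl
    · simp only [phase_mul, totalCocycle, Fin.sum_univ_three, swapCoord]
      simp [coeffOp]
      exact add_comm _ _

/-- The automorphism of the modified group which exchanges the factors `0` and `1`. -/
def swapOp : CentralProduct coeff ≃ CentralProduct coeff :=
  (invEquiv.trans swapEquiv.toEquiv).trans invEquiv.symm

theorem swapOp_mulOp (x y : CentralProduct coeff) :
    swapOp (mulOp x y) = mulOp (swapOp x) (swapOp y) := by
  simp [swapOp, mulOp]

theorem swapOp_swapOp (x : CentralProduct coeff) : swapOp (swapOp x) = x := by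
  simp only [swapOp, Equiv.trans_apply, Equiv.apply_symm_apply]
  rw [Equiv.symm_apply_eq]
  exact swapEquiv.symm_apply_apply _

theorem coord_swapOp_eq_one {x : CentralProduct coeff} {i : Fin 3} :
    (swapOp x).coord i = 1 ↔ x.coord (Equiv.swap 0 1 i) = 1 := by
  fin_cases i
  · change (x.coord 1)⁻¹ = 1 ↔ x.coord 1 = 1
    simp
  · change (x.coord 0)⁻¹ = 1 ↔ x.coord 0 = 1
    simp
  · exact Iff.rfl

theorem image_swapOp :
    swapOp '' (factor coeff 0 : Set (CentralProduct coeff)) = factor coeff 1 := by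
  rw [Equiv.image_eq_preimage_symm]
  ext x
  have hx : swapOp.symm x = swapOp x := by rw [Equiv.symm_apply_eq, swapOp_swapOp]
  rw [Set.mem_preimage, hx, SetLike.mem_coe, SetLike.mem_coe, mem_factor, mem_factor]
  simp only [coord_swapOp_eq_one]
  have hswap : ∀ j : Fin 3, j ≠ 1 → Equiv.swap 0 1 j ≠ 0 := by decide
  constructor
  · intro h j hj
    have := h (Equiv.swap 0 1 j)
    rw [Equiv.swap_apply_self] at this
    exact this (hswap j hj)
  · intro h j hj
    exact h _ (by revert j; decide)

theorem coeff_ne_zero : ∀ i, coeff i ≠ 0 := by decide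

end Opposite

end TwistedCentralProduct

open TwistedCentralProduct CentralProduct

/-- Proposition 7.10: there is a finite group `G` which is the central product of
three perfect, centrally indecomposable characteristic subgroups `Q₁, Q₂, Q₃`,
such that in the group `(G, ∘)` obtained by replacing `Q₁` with its opposite,
some automorphism exchanges `Q₁` and `Q₂`, so `Q₁` and `Q₂` are not
characteristic in `(G, ∘)`. -/
theorem exists_central_product_losing_characteristic :
    ∃ (G : Type) (_ : Group G) (_ : Finite G) (Q₁ Q₂ Q₃ : Subgroup G)
      (mul' : G → G → G),
      -- the Qᵢ are perfect and centrally indecomposable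
      (⁅Q₁, Q₁⁆ = Q₁ ∧ ⁅Q₂, Q₂⁆ = Q₂ ∧ ⁅Q₃, Q₃⁆ = Q₃) ∧
      (CentrallyIndecomposable Q₁ ∧ CentrallyIndecomposable Q₂ ∧
        CentrallyIndecomposable Q₃) ∧
      -- G is the central product of Q₁, Q₂, Q₃
      (∀ a ∈ Q₁, ∀ b ∈ Q₂, a * b = b * a) ∧
      (∀ a ∈ Q₁, ∀ c ∈ Q₃, a * c = c * a) ∧
      (∀ b ∈ Q₂, ∀ c ∈ Q₃, b * c = c * b) ∧
      (∀ g : G, ∃ a ∈ Q₁, ∃ b ∈ Q₂, ∃ c ∈ Q₃, g = a * b * c) ∧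
      -- (1) each Qᵢ is characteristic in G
      (Q₁.Characteristic ∧ Q₂.Characteristic ∧ Q₃.Characteristic) ∧
      -- (2) ∘ is a group operation with the same identity ...
      (∀ x y z : G, mul' (mul' x y) z = mul' x (mul' y z)) ∧
      (∀ x : G, mul' 1 x = x ∧ mul' x 1 = x) ∧
      (∀ x : G, ∃ y : G, mul' x y = 1 ∧ mul' y x = 1) ∧
      -- ... obtained from G by replacing Q₁ with its opposite
      (∀ a ∈ Q₁, ∀ b ∈ Q₂, ∀ c ∈ Q₃, ∀ a' ∈ Q₁, ∀ b' ∈ Q₂, ∀ c' ∈ Q₃,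
        mul' (a * b * c) (a' * b' * c') = (a' * a) * (b * b') * (c * c')) ∧
      -- (3) an automorphism of (G, ∘) maps Q₁ onto Q₂, and Q₁ ≠ Q₂
      (∃ f : G ≃ G, (∀ x y : G, f (mul' x y) = mul' (f x) (f y)) ∧
        f '' (Q₁ : Set G) = (Q₂ : Set G)) ∧
      (Q₁ : Set G) ≠ (Q₂ : Set G) := by
  have hε := coeff_ne_zero
  have hne : coeff 0 ^ 5 ≠ coeff 1 ^ 5 := by decide
  have hone : invEquiv.symm 1 = 1 := invEquiv.symm_apply_eq.2 invEquiv_one.symm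
  have hirr : ∀ i, CentrallyIndecomposable (factor coeff i) := fun i =>
    (normalJoinIrreducible_factor (hε i)).centrallyIndecomposable
  refine ⟨CentralProduct coeff, inferInstance, inferInstance, factor coeff 0, factor coeff 1,
    factor coeff 2, mulOp,
    ⟨commutator_factor (hε 0), commutator_factor (hε 1), commutator_factor (hε 2)⟩,
    ⟨hirr 0, hirr 1, hirr 2⟩,
    fun a ha b hb => commute_of_mem (by decide) ha hb,
    fun a ha b hb => commute_of_mem (by decide) ha hb,
    fun a ha b hb => commute_of_mem (by decide) ha hb,
    exists_eq_mul,
    ⟨factor_characteristic hε hne 0, factor_characteristic hε hne 1,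
      factor_characteristic hε hne 2⟩,
    fun x y z => ?_, fun x => ⟨?_, ?_⟩, fun x => ⟨invEquiv.symm (invEquiv x)⁻¹, ?_, ?_⟩,
    fun a ha b hb c hc a' ha' b' hb' c' hc' => mulOp_mul ha hb hc ha' hb' hc',
    ⟨swapOp, swapOp_mulOp, image_swapOp⟩, fun h => ?_⟩
  · simp [mulOp, mul_assoc]
  · simp [mulOp, invEquiv_one]
  · simp [mulOp, invEquiv_one]
  · simp [mulOp, hone]
  · simp [mulOp, hone]
  · exact absurd (eq_of_factor_le (SetLike.coe_injective h).le) (by decide)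
end

section
/- There exist a finite group G and subgroups Q₁, Q₂ of G, each perfect and centrally indecomposable, with [Q₁, Q₂] = 1 and Q₁Q₂ = G, such that: (1) Q₁ and Q₂ are characteristic subgroups of G; (2) there is a second group structure ∘ on the underlying set of G, with the same identity, satisfying (q₁q₂) ∘ (q₁'q₂') = (q₁'q₁)(q₂q₂') for all qᵢ, qᵢ' ∈ Qᵢ (i.e. the group obtained from G by replacing Q₁ with its opposite); (3) the group (G, ∘) is not isomorphic to G; and (4) Q₁ and Q₂ are still characteristic subgroups of (G, ∘). -/
section Auxiliary

open scoped MatrixGroups commutatorElement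
open Matrix

/-- The standard symplectic form on the plane. -/
def symplecticForm {R : Type*} [CommRing R] (v w : Fin 2 → R) : R :=
  v 0 * w 1 - v 1 * w 0

section SymplecticForm

variable {R : Type*} [CommRing R]

lemma symplecticForm_mulVec (M : Matrix (Fin 2) (Fin 2) R) (v w : Fin 2 → R) :
    symplecticForm (M *ᵥ v) (M *ᵥ w) = M.det * symplecticForm v w := by
  simp only [symplecticForm, mulVec, dotProduct, Fin.sum_univ_two, det_fin_two]
  ring

lemma symplecticForm_add_left (u v w : Fin 2 → R) :
    symplecticForm (u + v) w = symplecticForm u w + symplecticForm v w := by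
  simp only [symplecticForm, Pi.add_apply]
  ring

lemma symplecticForm_add_right (u v w : Fin 2 → R) :
    symplecticForm u (v + w) = symplecticForm u v + symplecticForm u w := by
  simp only [symplecticForm, Pi.add_apply]
  ring

@[simp] lemma symplecticForm_neg_left (v w : Fin 2 → R) :
    symplecticForm (-v) w = -symplecticForm v w := by
  simp only [symplecticForm, Pi.neg_apply]
  ring

@[simp] lemma symplecticForm_self (v : Fin 2 → R) : symplecticForm v v = 0 := by
  simp only [symplecticForm]
  ring

lemma symplecticForm_swap (v w : Fin 2 → R) : symplecticForm w v = -symplecticForm v w := by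
  simp only [symplecticForm]
  ring

@[simp] lemma symplecticForm_zero_left (w : Fin 2 → R) : symplecticForm 0 w = 0 := by
  simp [symplecticForm]

@[simp] lemma symplecticForm_zero_right (v : Fin 2 → R) : symplecticForm v 0 = 0 := by
  simp [symplecticForm]

lemma symplecticForm_smul_right (r : R) (v w : Fin 2 → R) :
    symplecticForm v (r • w) = r * symplecticForm v w := by
  simp only [symplecticForm, Pi.smul_apply, smul_eq_mul]
  ring

@[simp] lemma symplecticForm_single (a b : R) :
    symplecticForm (Pi.single 0 a) (Pi.single 1 b) = a * b := by
  simp [symplecticForm]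

@[simp] lemma symplecticForm_specialLinear (g : SL(2, R)) (v w : Fin 2 → R) :
    symplecticForm (g.1 *ᵥ v) (g.1 *ᵥ w) = symplecticForm v w := by
  rw [symplecticForm_mulVec, g.2, one_mul]

end SymplecticForm

/-- The semidirect product by `S ≤ SL(2, p)` of the product of the Heisenberg group of order `p ^ 3`
with `n` copies of the natural module. The zeroth vector and `cen` are the coordinates of the
Heisenberg group. -/
@[ext] structure HeisenbergExtension {p : ℕ} (S : Subgroup SL(2, ZMod p)) (n : ℕ) where
  vec : Fin (n + 1) → Fin 2 → ZMod p
  cen : ZMod p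
  top : S

namespace HeisenbergExtension

variable {p : ℕ} {S : Subgroup SL(2, ZMod p)} {n : ℕ}

instance : Mul (HeisenbergExtension S n) where
  mul x y := ⟨fun i => x.vec i + x.top.1.1 *ᵥ y.vec i,
    x.cen + y.cen + symplecticForm (x.vec 0) (x.top.1.1 *ᵥ y.vec 0), x.top * y.top⟩

instance : One (HeisenbergExtension S n) where
  one := ⟨0, 0, 1⟩

instance : Inv (HeisenbergExtension S n) where
  inv x := ⟨fun i => -((x.top⁻¹).1.1 *ᵥ x.vec i), -x.cen, x.top⁻¹⟩

lemma vec_mul (x y : HeisenbergExtension S n) (i : Fin (n + 1)) :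
    (x * y).vec i = x.vec i + x.top.1.1 *ᵥ y.vec i := rfl

lemma cen_mul (x y : HeisenbergExtension S n) :
    (x * y).cen = x.cen + y.cen + symplecticForm (x.vec 0) (x.top.1.1 *ᵥ y.vec 0) := rfl

@[simp] lemma top_mul (x y : HeisenbergExtension S n) : (x * y).top = x.top * y.top := rfl

@[simp] lemma vec_one : (1 : HeisenbergExtension S n).vec = 0 := rfl

@[simp] lemma cen_one : (1 : HeisenbergExtension S n).cen = 0 := rfl

@[simp] lemma top_one : (1 : HeisenbergExtension S n).top = 1 := rfl

lemma vec_inv (x : HeisenbergExtension S n) (i : Fin (n + 1)) :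
    x⁻¹.vec i = -((x.top⁻¹).1.1 *ᵥ x.vec i) := rfl

@[simp] lemma cen_inv (x : HeisenbergExtension S n) : x⁻¹.cen = -x.cen := rfl

@[simp] lemma top_inv (x : HeisenbergExtension S n) : x⁻¹.top = x.top⁻¹ := rfl

lemma coe_mul_mulVec (s t : S) (v : Fin 2 → ZMod p) :
    (s * t).1.1 *ᵥ v = s.1.1 *ᵥ (t.1.1 *ᵥ v) := by
  rw [mulVec_mulVec]
  rfl

@[simp] lemma coe_one_mulVec (v : Fin 2 → ZMod p) : (1 : S).1.1 *ᵥ v = v :=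
  one_mulVec v

instance : Group (HeisenbergExtension S n) :=
  Group.ofLeftAxioms
    (fun x y z => by
      ext : 1
      · funext i
        simp only [vec_mul, top_mul, coe_mul_mulVec, mulVec_add, add_assoc]
      · simp only [cen_mul, vec_mul, top_mul, coe_mul_mulVec, mulVec_add,
          symplecticForm_add_left, symplecticForm_add_right, symplecticForm_specialLinear]
        ring
      · exact mul_assoc _ _ _)
    (fun x => by
      ext : 1
      · funext i
        simp [vec_mul]
      · simp [cen_mul]
      · exact one_mul _)
    (fun x => by
      ext : 1
      · funext i
        simp [vec_mul, vec_inv]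
      · simp only [cen_mul, vec_inv, cen_inv, top_inv, cen_one, symplecticForm_neg_left,
          symplecticForm_self]
        ring
      · exact inv_mul_cancel _)

/-- The underlying set as a product. -/
def equivProd : HeisenbergExtension S n ≃ (Fin (n + 1) → Fin 2 → ZMod p) × ZMod p × S where
  toFun x := (x.vec, x.cen, x.top)
  invFun x := ⟨x.1, x.2.1, x.2.2⟩

instance finite [NeZero p] : Finite (HeisenbergExtension S n) :=
  have : Finite SL(2, ZMod p) := Subtype.finite
  Finite.of_equiv _ equivProd.symm

lemma card_strictMono [Fact p.Prime] :
    StrictMono fun n => Nat.card (HeisenbergExtension S n) := by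
  have : Finite SL(2, ZMod p) := Subtype.finite
  have hp := (Fact.out : p.Prime)
  intro m n hmn
  simp only [Nat.card_congr equivProd, Nat.card_prod, Nat.card_fun, Nat.card_fin, Nat.card_zmod]
  have hS : 0 < p * Nat.card S := Nat.mul_pos hp.pos Nat.card_pos
  have h1 : 1 < p ^ 2 := Nat.one_lt_pow two_ne_zero hp.one_lt
  gcongr

/-- The embedding of the top group. -/
def ofTop : S →* HeisenbergExtension S n where
  toFun s := ⟨0, 0, s⟩
  map_one' := rfl
  map_mul' s t := by
    ext : 1
    · funext i
      simp [vec_mul]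
    · simp [cen_mul]
    · rfl

/-- The embedding of the center of the Heisenberg group. -/
def ofCenter : Multiplicative (ZMod p) →* HeisenbergExtension S n where
  toFun c := ⟨0, c.toAdd, 1⟩
  map_one' := rfl
  map_mul' c d := by
    ext : 1
    · funext i
      simp [vec_mul]
    · simp [cen_mul]
    · exact (one_mul _).symm

/-- The element with given vector part and all other coordinates trivial. -/
def ofVec (u : Fin (n + 1) → Fin 2 → ZMod p) : HeisenbergExtension S n := ⟨u, 0, 1⟩

@[simp] lemma vec_ofTop (s : S) : (ofTop s : HeisenbergExtension S n).vec = 0 := rfl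
@[simp] lemma cen_ofTop (s : S) : (ofTop s : HeisenbergExtension S n).cen = 0 := rfl
@[simp] lemma top_ofTop (s : S) : (ofTop s : HeisenbergExtension S n).top = s := rfl
@[simp] lemma vec_ofCenter (c) : (ofCenter c : HeisenbergExtension S n).vec = 0 := rfl
@[simp] lemma cen_ofCenter (c) : (ofCenter c : HeisenbergExtension S n).cen = c.toAdd := rfl
@[simp] lemma top_ofCenter (c) : (ofCenter c : HeisenbergExtension S n).top = 1 := rfl
@[simp] lemma vec_ofVec (u) : (ofVec u : HeisenbergExtension S n).vec = u := rfl
@[simp] lemma cen_ofVec (u) : (ofVec u : HeisenbergExtension S n).cen = 0 := rfl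
@[simp] lemma top_ofVec (u) : (ofVec u : HeisenbergExtension S n).top = 1 := rfl

lemma ofCenter_injective : Function.Injective (ofCenter : _ →* HeisenbergExtension S n) :=
  fun _ _ h => congrArg cen h

lemma ofCenter_mem_center (c : Multiplicative (ZMod p)) :
    (ofCenter c : HeisenbergExtension S n) ∈ Subgroup.center (HeisenbergExtension S n) := by
  refine Subgroup.mem_center_iff.2 fun x => ?_
  ext : 1
  · funext i
    simp [vec_mul]
  · simp [cen_mul, add_comm]
  · simp

lemma ofVec_mul_ofVec (u v : Fin (n + 1) → Fin 2 → ZMod p) :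
    (ofVec u * ofVec v : HeisenbergExtension S n) =
      ofVec (u + v) * ofCenter (.ofAdd (symplecticForm (u 0) (v 0))) := by
  ext : 1
  · funext i
    simp [vec_mul]
  · simp [cen_mul]
  · simp

lemma ofTop_mul_ofVec (s : S) (u : Fin (n + 1) → Fin 2 → ZMod p) :
    (ofTop s * ofVec u : HeisenbergExtension S n) =
      ofVec (fun i => s.1.1 *ᵥ u i) * ofTop s := by
  ext : 1
  · funext i
    simp [vec_mul]
  · simp [cen_mul]
  · simp

lemma eq_ofVec_mul_ofCenter_mul_ofTop (x : HeisenbergExtension S n) :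
    x = ofVec x.vec * ofCenter (.ofAdd x.cen) * ofTop x.top := by
  ext : 1
  · funext i
    simp [vec_mul]
  · simp [cen_mul]
  · simp

lemma commutator_of_top_eq_one {x y : HeisenbergExtension S n} (hx : x.top = 1) (hy : y.top = 1) :
    ⁅x, y⁆ = ofCenter (.ofAdd (2 * symplecticForm (x.vec 0) (y.vec 0))) := by
  rw [commutatorElement_def, mul_inv_eq_iff_eq_mul, mul_inv_eq_iff_eq_mul]
  ext : 1
  · funext i
    simp [vec_mul, hx, hy, add_comm]
  · simp only [cen_mul, vec_mul, vec_ofCenter, cen_ofCenter, top_ofCenter, hx, hy, top_mul,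
      coe_one_mulVec, mul_one, Pi.zero_apply, zero_add, symplecticForm_zero_left, toAdd_ofAdd]
    rw [symplecticForm_swap (x.vec 0) (y.vec 0)]
    ring
  · simp [hx, hy]

end HeisenbergExtension

/-- A group is the central product of two subgroups if they commute and generate it. -/
structure IsCentralProduct {G : Type*} [Group G] (A B : Subgroup G) : Prop where
  commute : ∀ a ∈ A, ∀ b ∈ B, a * b = b * a
  exists_eq_mul : ∀ g : G, ∃ a ∈ A, ∃ b ∈ B, g = a * b

namespace IsCentralProduct

variable {G : Type*} [Group G] {A B : Subgroup G}

lemma symm (h : IsCentralProduct A B) : IsCentralProduct B A where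
  commute b hb a ha := (h.commute a ha b hb).symm
  exists_eq_mul g := by
    obtain ⟨a, ha, b, hb, rfl⟩ := h.exists_eq_mul g
    exact ⟨b, hb, a, ha, h.commute a ha b hb⟩

lemma map {H : Type*} [Group H] (h : IsCentralProduct A B) {f : G →* H}
    (hf : Function.Surjective f) : IsCentralProduct (A.map f) (B.map f) where
  commute := by
    rintro _ ⟨a, ha, rfl⟩ _ ⟨b, hb, rfl⟩
    rw [← map_mul, h.commute a ha b hb, map_mul]
  exists_eq_mul g := by
    obtain ⟨g, rfl⟩ := hf g
    obtain ⟨a, ha, b, hb, rfl⟩ := h.exists_eq_mul g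
    exact ⟨f a, ⟨a, ha, rfl⟩, f b, ⟨b, hb, rfl⟩, map_mul f a b⟩

lemma normal_left (h : IsCentralProduct A B) : A.Normal where
  conj_mem x hx g := by
    obtain ⟨a, ha, b, hb, rfl⟩ := h.exists_eq_mul g
    have : a * b * x * (a * b)⁻¹ = a * x * a⁻¹ := by
      rw [mul_assoc a b x, ← h.commute x hx b hb]
      group
    rw [this]
    exact A.mul_mem (A.mul_mem ha hx) (A.inv_mem ha)

lemma normal_right (h : IsCentralProduct A B) : B.Normal := h.symm.normal_left

lemma sup_eq_top (h : IsCentralProduct A B) : A ⊔ B = ⊤ := by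
  refine eq_top_iff.2 fun g _ => ?_
  obtain ⟨a, ha, b, hb, rfl⟩ := h.exists_eq_mul g
  exact Subgroup.mul_mem_sup ha hb

lemma right_le_center (h : IsCentralProduct A B) (hA : A = ⊤) : B ≤ Subgroup.center G :=
  fun b hb => Subgroup.mem_center_iff.2 fun g => h.commute g (hA ▸ Subgroup.mem_top g) b hb

/-- If one factor of a perfect group is central, the other is the whole group. -/
lemma right_eq_top_of_le_center (h : IsCentralProduct A B) (hG : commutator G = ⊤)
    (hA : A ≤ Subgroup.center G) : B = ⊤ := by
  refine eq_top_iff.2 (hG ▸ Subgroup.commutator_le.2 fun g _ x _ => ?_)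
  obtain ⟨a, ha, b, hb, rfl⟩ := h.exists_eq_mul g
  have hc := Subgroup.mem_center_iff.1 (hA ha) (b * x * b⁻¹)
  have : ⁅a * b, x⁆ = b * (x * b⁻¹ * x⁻¹) := by
    calc ⁅a * b, x⁆ = a * (b * x * b⁻¹) * a⁻¹ * x⁻¹ := by
          rw [commutatorElement_def]; group
      _ = b * (x * b⁻¹ * x⁻¹) := by rw [← hc]; group
  rw [this]
  exact B.mul_mem hb (h.normal_right.conj_mem _ (B.inv_mem hb) x)

/-- If centralizers of noncentral elements of a perfect group are commutative, then the group is
not a product of two commuting proper subgroups. -/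
lemma eq_top_or_eq_top (h : IsCentralProduct A B) (hG : commutator G = ⊤)
    (hcomm : ∀ m x y : G, m ∉ Subgroup.center G → Commute x m → Commute y m → Commute x y) :
    A = ⊤ ∨ B = ⊤ := by
  by_cases hA : A ≤ Subgroup.center G
  · exact .inr (h.right_eq_top_of_le_center hG hA)
  obtain ⟨m, hm, hmc⟩ := SetLike.not_le_iff_exists.1 hA
  refine .inl (h.symm.right_eq_top_of_le_center hG fun b hb =>
    Subgroup.mem_center_iff.2 fun g => ?_)
  obtain ⟨a, ha, b', hb', rfl⟩ := h.exists_eq_mul g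
  have hbb : b' * b = b * b' :=
    hcomm m b' b hmc (h.commute m hm b' hb').symm (h.commute m hm b hb).symm
  rw [mul_assoc, hbb, ← mul_assoc, h.commute a ha b hb, mul_assoc]

end IsCentralProduct

lemma centrallyIndecomposable_iff {Q : Type*} [Group Q] :
    CentrallyIndecomposable Q ↔ ∀ A B : Subgroup Q, IsCentralProduct A B →
      A ≤ Subgroup.center Q ∨ B ≤ Subgroup.center Q :=
  ⟨fun h A B hAB => h A B hAB.1 hAB.2, fun h A B h₁ h₂ => h A B ⟨h₁, h₂⟩⟩

lemma CentrallyIndecomposable.of_mulEquiv {Q R : Type*} [Group Q] [Group R] (e : Q ≃* R)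
    (hQ : CentrallyIndecomposable Q) : CentrallyIndecomposable R := by
  have key (A : Subgroup R) (hA : A.map e.symm.toMonoidHom ≤ Subgroup.center Q) :
      A ≤ Subgroup.center R := fun a ha => Subgroup.mem_center_iff.2 fun g => by
    simpa using congrArg e (Subgroup.mem_center_iff.1 (hA ⟨a, ha, rfl⟩) (e.symm g))
  refine centrallyIndecomposable_iff.2 fun A B h => ?_
  exact (centrallyIndecomposable_iff.1 hQ _ _ (h.map e.symm.surjective)).imp (key A) (key B)

lemma commutator_range {K P : Type*} [Group K] [Group P] (hK : commutator K = ⊤) (f : K →* P) :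
    ⁅f.range, f.range⁆ = f.range := by
  rw [MonoidHom.range_eq_map, ← Subgroup.map_commutator, ← commutator_def, hK]

section Uniqueness

variable {G : Type*} [Group G] {Q Q₁ Q₂ P₁ P₂ : Subgroup G}

lemma le_or_le_of_centrallyIndecomposable (hQ : ⁅Q, Q⁆ = Q) (hind : CentrallyIndecomposable Q)
    [Q.Normal] (hP : IsCentralProduct P₁ P₂) : Q ≤ P₁ ∨ Q ≤ P₂ := by
  have := hP.normal_left
  have := hP.normal_right
  have hle : Q ≤ (Q ⊓ P₁) ⊔ (Q ⊓ P₂) := by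
    conv_lhs => rw [← hQ]
    refine (Subgroup.commutator_mono le_rfl (le_top (a := Q))).trans ?_
    rw [← hP.sup_eq_top, Subgroup.commutator_le]
    intro q hq g hg
    rw [hP.sup_eq_top] at hg
    obtain ⟨a, ha, b, hb, rfl⟩ := hP.exists_eq_mul g
    have : ⁅q, a * b⁆ = ⁅q, a⁆ * (a * ⁅q, b⁆ * a⁻¹) := by
      simp only [commutatorElement_def]; group
    rw [this]
    refine Subgroup.mul_mem_sup
      (Subgroup.commutator_le_inf _ _ (Subgroup.commutator_mem_commutator hq ha)) ?_
    exact Subgroup.Normal.conj_mem inferInstance _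
      (Subgroup.commutator_le_inf _ _ (Subgroup.commutator_mem_commutator hq hb)) a
  have hcp : IsCentralProduct (P₁.subgroupOf Q) (P₂.subgroupOf Q) := by
    refine ⟨fun a ha b hb => Subtype.ext (hP.commute a ha b hb), fun q => ?_⟩
    obtain ⟨a, ha, b, hb, hab⟩ := Subgroup.mem_sup_of_normal_right.1 (hle q.2)
    exact ⟨⟨a, ha.1⟩, ha.2, ⟨b, hb.1⟩, hb.2, Subtype.ext hab.symm⟩
  have hperf : commutator Q = ⊤ := by
    apply Subgroup.map_injective Q.subtype_injective
    rw [Subgroup.map_subtype_commutator, hQ, ← MonoidHom.range_eq_map, Subgroup.range_subtype]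
  rcases centrallyIndecomposable_iff.1 hind _ _ hcp with h | h
  · exact .inr (Subgroup.subgroupOf_eq_top.1 (hcp.right_eq_top_of_le_center hperf h))
  · exact .inl (Subgroup.subgroupOf_eq_top.1 (hcp.symm.right_eq_top_of_le_center hperf h))

/-- Decompositions of a finite group into two perfect, centrally indecomposable factors of
distinct orders are unique. -/
lemma IsCentralProduct.unique [Finite G] (hQ : IsCentralProduct Q₁ Q₂) (hP : IsCentralProduct P₁ P₂)
    (hQ₁ : ⁅Q₁, Q₁⁆ = Q₁) (hQ₂ : ⁅Q₂, Q₂⁆ = Q₂)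
    (hind₁ : CentrallyIndecomposable Q₁) (hind₂ : CentrallyIndecomposable Q₂)
    (hcard₁ : Nat.card Q₁ = Nat.card P₁) (hcard₂ : Nat.card Q₂ = Nat.card P₂)
    (hcard : Nat.card Q₁ < Nat.card Q₂) : Q₁ = P₁ ∧ Q₂ = P₂ := by
  have := hQ.normal_left
  have := hQ.normal_right
  have h₂ : Q₂ = P₂ := by
    rcases le_or_le_of_centrallyIndecomposable hQ₂ hind₂ hP with h | h
    · exact absurd (Subgroup.card_le_of_le h) (by omega)
    · exact Subgroup.eq_of_le_of_card_ge h hcard₂.ge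
  refine ⟨?_, h₂⟩
  rcases le_or_le_of_centrallyIndecomposable hQ₁ hind₁ hP with h | h
  · exact Subgroup.eq_of_le_of_card_ge h hcard₁.ge
  · have hbot : Q₁ = ⊥ := by
      rw [← hQ₁, Subgroup.commutator_eq_bot_iff_le_centralizer]
      exact fun a ha => Subgroup.mem_centralizer_iff.2 fun b hb =>
        hQ.commute b hb a (h₂ ▸ h ha)
    refine Subgroup.eq_of_le_of_card_ge ?_ hcard₁.ge
    simp [hbot]

end Uniqueness

lemma commute_of_commute_of_notMem_center {F : Type*} [Field F] (S : Subgroup SL(2, F))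
    (m x y : S) (hm : m ∉ Subgroup.center S) (hx : Commute x m) (hy : Commute y m) :
    Commute x y := by
  have ext_iff (s t : S) : Commute s t ↔ s.1.1 * t.1.1 = t.1.1 * s.1.1 :=
    ⟨fun h => congrArg (fun r : S => r.1.1) h, fun h => Subtype.ext (Subtype.ext h)⟩
  have key (s t : S) : Commute s t ↔ s.1.1 0 1 * t.1.1 1 0 = t.1.1 0 1 * s.1.1 1 0 ∧
      (s.1.1 0 0 - s.1.1 1 1) * t.1.1 0 1 = (t.1.1 0 0 - t.1.1 1 1) * s.1.1 0 1 ∧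
      (s.1.1 0 0 - s.1.1 1 1) * t.1.1 1 0 = (t.1.1 0 0 - t.1.1 1 1) * s.1.1 1 0 := by
    rw [ext_iff, ← Matrix.ext_iff]
    simp only [Fin.forall_fin_two, mul_apply, Fin.sum_univ_two]
    constructor
    · rintro ⟨⟨h₁, h₂⟩, h₃, h₄⟩
      exact ⟨by linear_combination h₁, by linear_combination h₂, by linear_combination -h₃⟩
    · rintro ⟨h₁, h₂, h₃⟩
      exact ⟨⟨by linear_combination h₁, by linear_combination h₂⟩,
        by linear_combination -h₃, by linear_combination -h₁⟩
  obtain ⟨hx₁, hx₂, hx₃⟩ := (key x m).1 hx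
  obtain ⟨hy₁, hy₂, hy₃⟩ := (key y m).1 hy
  rw [key]
  by_cases h₁ : m.1.1 0 1 = 0
  · by_cases h₂ : m.1.1 1 0 = 0
    · by_cases h₃ : m.1.1 0 0 - m.1.1 1 1 = 0
      · refine absurd (Subgroup.mem_center_iff.2 fun g => ?_) hm
        exact (key g m).2 (by simp [h₁, h₂, h₃])
      · refine ⟨mul_left_cancel₀ h₃ ?_, mul_left_cancel₀ h₃ ?_, mul_left_cancel₀ h₃ ?_⟩
        · simp only [h₁, h₂, mul_zero, zero_eq_mul, h₃, false_or] at hx₂ hx₃ hy₂ hy₃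
          simp [hx₂, hx₃]
        · linear_combination (y.1.1 0 0 - y.1.1 1 1) * hx₂ - (x.1.1 0 0 - x.1.1 1 1) * hy₂
        · linear_combination (y.1.1 0 0 - y.1.1 1 1) * hx₃ - (x.1.1 0 0 - x.1.1 1 1) * hy₃
    · refine ⟨mul_left_cancel₀ h₂ ?_, mul_left_cancel₀ h₂ ?_, mul_left_cancel₀ h₂ ?_⟩
      · linear_combination y.1.1 1 0 * hx₁ - x.1.1 1 0 * hy₁
      · linear_combination (x.1.1 0 0 - x.1.1 1 1) * hy₁ + y.1.1 1 0 * hx₂ - x.1.1 0 1 * hy₃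
      · linear_combination y.1.1 1 0 * hx₃ - x.1.1 1 0 * hy₃
  · refine ⟨mul_left_cancel₀ h₁ ?_, mul_left_cancel₀ h₁ ?_, mul_left_cancel₀ h₁ ?_⟩
    · linear_combination y.1.1 0 1 * hx₁ - x.1.1 0 1 * hy₁
    · linear_combination y.1.1 0 1 * hx₂ - x.1.1 0 1 * hy₂
    · linear_combination y.1.1 0 1 * hx₃ - (x.1.1 0 0 - x.1.1 1 1) * hy₁ - x.1.1 1 0 * hy₂

lemma ZMod.two_ne_zero_of_ne_two {p : ℕ} [Fact p.Prime] (hp : p ≠ 2) : (2 : ZMod p) ≠ 0 :=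
  Ring.two_ne_zero ((ZMod.ringChar_zmod_n p).trans_ne hp)

namespace HeisenbergExtension

variable {p : ℕ} {S : Subgroup SL(2, ZMod p)} {n : ℕ}

/-- The projection to the top group. -/
def topHom : HeisenbergExtension S n →* S where
  toFun := top
  map_one' := rfl
  map_mul' _ _ := rfl

lemma topHom_surjective : Function.Surjective (topHom : HeisenbergExtension S n →* S) :=
  fun s => ⟨ofTop s, rfl⟩

lemma neg_one_mulVec {s : S} (hs : s.1 = -1) (v : Fin 2 → ZMod p) : s.1.1 *ᵥ v = -v := by
  simp [hs, neg_mulVec]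

lemma ofVec_pow (u : Fin (n + 1) → Fin 2 → ZMod p) (k : ℕ) :
    (ofVec u : HeisenbergExtension S n) ^ k = ofVec (k • u) := by
  induction k with
  | zero => simp; rfl
  | succ k ih =>
    rw [pow_succ, ih, ofVec_mul_ofVec, succ_nsmul]
    have : symplecticForm ((k • u) 0) (u 0) = 0 := by
      rw [Pi.smul_apply, ← Nat.cast_smul_eq_nsmul (ZMod p), symplecticForm_swap,
        symplecticForm_smul_right]
      simp
    rw [this, ofAdd_zero, map_one, mul_one]

variable [Fact p.Prime]

lemma eq_top_of_map_topHom_eq_top (hp : p ≠ 2) (hneg : -1 ∈ S)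
    (A : Subgroup (HeisenbergExtension S n)) [A.Normal] (hA : A.map topHom = ⊤) : A = ⊤ := by
  have h2 := ZMod.two_ne_zero_of_ne_two hp
  have hlift (s : S) : ∃ a ∈ A, a.top = s := by
    obtain ⟨a, ha, h⟩ := (hA ▸ Subgroup.mem_top s : s ∈ A.map topHom)
    exact ⟨a, ha, h⟩
  have hcomm {a : HeisenbergExtension S n} (ha : a ∈ A) (x) : ⁅a, x⁆ ∈ A := by
    rw [commutatorElement_def, mul_assoc, mul_assoc, ← mul_assoc x]
    exact A.mul_mem ha (Subgroup.Normal.conj_mem inferInstance _ (A.inv_mem ha) x)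
  have hvec (u : Fin (n + 1) → Fin 2 → ZMod p) : ∃ a ∈ A, a.top = 1 ∧ a.vec = u := by
    obtain ⟨a, ha, hatop⟩ := hlift ⟨-1, hneg⟩
    set x : HeisenbergExtension S n := ofVec ((-2⁻¹ : ZMod p) • u)
    have htop : ⁅a, x⁆.top = 1 := by
      change topHom ⁅a, x⁆ = 1
      rw [map_commutatorElement]
      exact commutatorElement_one_right _
    refine ⟨_, hcomm ha x, htop, ?_⟩
    have hmul : ⁅a, x⁆ * (x * a) = a * x := by
      rw [commutatorElement_def]; group
    funext i
    have := congrFun (congrArg vec hmul) i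
    simp only [vec_mul, htop, coe_one_mulVec, top_ofVec, vec_ofVec, x, Pi.smul_apply,
      neg_one_mulVec (congrArg Subtype.val hatop)] at this
    have h : ⁅a, x⁆.vec i = (2 * 2⁻¹ : ZMod p) • u i := by
      simp only [x]
      rw [eq_sub_of_add_eq this]
      module
    rw [h, mul_inv_cancel₀ h2, one_smul]
  have hcen (c) : ofCenter c ∈ A := by
    obtain ⟨a, ha, hatop, hu⟩ := hvec (Pi.single 0 (Pi.single 0 (2⁻¹ * c.toAdd)))
    have := hcomm ha (ofVec (Pi.single 0 (Pi.single 1 1)))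
    rw [commutator_of_top_eq_one hatop (top_ofVec _), hu] at this
    simpa [h2] using this
  have hvec' (u) : ofVec u ∈ A := by
    obtain ⟨a, ha, hatop, rfl⟩ := hvec u
    have h := eq_ofVec_mul_ofCenter_mul_ofTop a
    rw [hatop, map_one, mul_one] at h
    rw [h] at ha
    exact (A.mul_mem_cancel_right (hcen _)).1 ha
  refine eq_top_iff.2 fun x _ => ?_
  obtain ⟨a, ha, hax⟩ := hlift x.top
  have htop : ofTop x.top ∈ A := by
    rw [← hax]
    rw [eq_ofVec_mul_ofCenter_mul_ofTop a] at ha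
    exact (A.mul_mem_cancel_left (A.mul_mem (hvec' _) (hcen _))).1 ha
  rw [eq_ofVec_mul_ofCenter_mul_ofTop x]
  exact A.mul_mem (A.mul_mem (hvec' _) (hcen _)) htop

lemma commutator_eq_top (hp : p ≠ 2) (hneg : -1 ∈ S) (hS : commutator S = ⊤) :
    commutator (HeisenbergExtension S n) = ⊤ := by
  refine eq_top_of_map_topHom_eq_top hp hneg _ ?_
  rw [commutator_def, Subgroup.map_commutator, ← MonoidHom.range_eq_map,
    MonoidHom.range_eq_top.2 topHom_surjective, ← commutator_def, hS]

lemma centrallyIndecomposable (hp : p ≠ 2) (hneg : -1 ∈ S) (hS : commutator S = ⊤) :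
    CentrallyIndecomposable (HeisenbergExtension S n) := by
  refine centrallyIndecomposable_iff.2 fun A B h => ?_
  have := h.normal_left
  have := h.normal_right
  rcases (h.map topHom_surjective).eq_top_or_eq_top hS
    (commute_of_commute_of_notMem_center S) with hA | hB
  · exact .inr (h.right_le_center (eq_top_of_map_topHom_eq_top hp hneg A hA))
  · exact .inl (h.symm.right_le_center (eq_top_of_map_topHom_eq_top hp hneg B hB))

lemma mem_center_iff (hp : p ≠ 2) (hneg : -1 ∈ S) (x : HeisenbergExtension S n) :
    x ∈ Subgroup.center (HeisenbergExtension S n) ↔ ∃ c, ofCenter c = x := by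
  refine ⟨fun hx => ?_, ?_⟩
  · rw [Subgroup.mem_center_iff] at hx
    have hvec : x.vec = 0 := by
      funext i j
      have h := congrFun (congrFun (congrArg vec (hx (ofTop ⟨-1, hneg⟩))) i) j
      rw [vec_mul, vec_mul, top_ofTop, neg_one_mulVec rfl] at h
      have h' : 2 * x.vec i j = 0 := by
        simp at h
        linear_combination -h
      simpa [ZMod.two_ne_zero_of_ne_two hp] using h'
    have htop : x.top = 1 := by
      apply Subtype.ext
      apply Subtype.ext
      refine Matrix.ext_of_mulVec_single fun i => ?_
      have h := congrFun (congrArg vec (hx (ofVec fun _ => Pi.single i 1))) 0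
      simp only [vec_mul, hvec, vec_ofVec, top_ofVec, coe_one_mulVec, Pi.zero_apply, zero_add,
        add_zero] at h
      rw [← h]
      exact (one_mulVec _).symm
    refine ⟨.ofAdd x.cen, ?_⟩
    ext : 1 <;> simp [hvec, htop]
  · rintro ⟨c, rfl⟩
    exact ofCenter_mem_center c

/-- An automorphism induces a linear map on the natural module that normalizes `S` and scales
the center by its determinant. -/
lemma exists_matrix_of_mulEquiv (hp : p ≠ 2) (hneg : -1 ∈ S)
    (hS : ∀ s : S, s ^ p = 1 → s = 1) (α : HeisenbergExtension S n ≃* HeisenbergExtension S n) :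
    ∃ M : Matrix (Fin 2) (Fin 2) (ZMod p), M.det ≠ 0 ∧
      (∀ s ∈ S, ∃ t ∈ S, M * s.1 = t.1 * M) ∧
      ∀ c : ZMod p, α (ofCenter (.ofAdd c)) = ofCenter (.ofAdd (M.det * c)) := by
  have h2 := ZMod.two_ne_zero_of_ne_two hp
  have htop (u) : (α (ofVec u)).top = 1 := by
    apply hS
    change topHom (α (ofVec u)) ^ p = 1
    rw [← map_pow, ← map_pow, ofVec_pow, ← Nat.cast_smul_eq_nsmul (ZMod p)]
    simp only [CharP.cast_eq_zero, zero_smul]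
    rw [show (ofVec 0 : HeisenbergExtension S n) = 1 from rfl, map_one, map_one]
  have hcen (c) : ∃ d, α (ofCenter c) = ofCenter d := by
    obtain ⟨d, hd⟩ := (mem_center_iff hp hneg (α (ofCenter c))).1
      (Subgroup.mem_center_iff.2 fun g => by
        simpa using congrArg α (Subgroup.mem_center_iff.1 (ofCenter_mem_center c) (α.symm g)))
    exact ⟨d, hd.symm⟩
  let f : (Fin 2 → ZMod p) →+ (Fin 2 → ZMod p) :=
    AddMonoidHom.mk' (fun v => (α (ofVec (Pi.single 0 v))).vec 0) fun v w => by
      have h := congrArg (fun x => (α x).vec 0)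
        (ofVec_mul_ofVec (S := S) (n := n) (Pi.single 0 v) (Pi.single 0 w))
      obtain ⟨d, hd⟩ := hcen (.ofAdd (symplecticForm v w))
      simp only [map_mul, vec_mul, htop, coe_one_mulVec, ← Pi.single_add, Pi.single_eq_same,
        hd] at h
      simpa using h.symm
  let M := LinearMap.toMatrix' (f.toZModLinearMap p)
  have hM (v) : (α (ofVec (Pi.single 0 v))).vec 0 = M *ᵥ v := by
    rw [← toLin'_apply, toLin'_toMatrix']
    rfl
  have hdet (c : ZMod p) : α (ofCenter (.ofAdd c)) = ofCenter (.ofAdd (M.det * c)) := by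
    have h := congrArg α (commutator_of_top_eq_one (S := S) (n := n)
      (top_ofVec (Pi.single 0 (Pi.single 0 (2⁻¹ * c))))
      (top_ofVec (Pi.single 0 (Pi.single 1 1))))
    rw [map_commutatorElement, commutator_of_top_eq_one (htop _) (htop _), hM, hM,
      symplecticForm_mulVec] at h
    simp only [vec_ofVec, Pi.single_eq_same, symplecticForm_single, mul_one,
      mul_inv_cancel_left₀ h2] at h
    rw [← h]
    congr 2
    field_simp
  refine ⟨M, fun h0 => ?_, fun s hs => ?_, hdet⟩
  · have := α.injective ((hdet 1).trans ((hdet 0).trans (by simp [h0])).symm)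
    simpa using ofCenter_injective this
  · refine ⟨_, (α (ofTop ⟨s, hs⟩)).top.2, Matrix.ext_of_mulVec_single fun i => ?_⟩
    have h := congrArg (fun x => (α x).vec 0)
      (ofTop_mul_ofVec (n := n) ⟨s, hs⟩ (Pi.single 0 (Pi.single i 1)))
    have hsingle : (fun j => s.1 *ᵥ (Pi.single 0 (Pi.single i 1) : Fin (n + 1) → _) j) =
        Pi.single 0 (s.1 *ᵥ Pi.single i 1) := by
      funext j
      by_cases hj : j = 0
      · subst hj; simp
      · simp [hj]
    rw [hsingle] at h
    simp only [map_mul, vec_mul, htop, coe_one_mulVec, hM] at h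
    rw [← mulVec_mulVec, ← mulVec_mulVec]
    exact (add_left_cancel ((add_comm _ _).trans h.symm))

end HeisenbergExtension

lemma Matrix.SpecialLinearGroup.val_mul {n R : Type*} [Fintype n] [DecidableEq n] [CommRing R]
    (A B : SpecialLinearGroup n R) : (A * B).1 = A.1 * B.1 := rfl

section BinaryIcosahedral

instance fact_prime_eleven : Fact (Nat.Prime 11) := ⟨by norm_num⟩

/-- A diagonal generator of order `10`. -/
def icosahedralDiag : SL(2, ZMod 11) := ⟨!![2, 0; 0, 6], by decide⟩

/-- A symmetric generator of order `10`. -/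
def icosahedralSymm : SL(2, ZMod 11) := ⟨!![1, 1; 1, 2], by decide⟩

/-- A copy of the binary icosahedral group `SL(2, 5)` in `SL(2, 11)`. -/
def binaryIcosahedral : Subgroup SL(2, ZMod 11) :=
  Subgroup.closure {icosahedralDiag, icosahedralSymm}

/-- Equations satisfied by the entries of the elements of `binaryIcosahedral`. -/
def IcosahedralEquations (x y z w : ZMod 11) : Prop :=
  x * w - y * z = 1 ∧ (x * y) ^ 5 = 2 * (x * w) * (y * z) * (x * w + y * z) ∧
    (z * w) ^ 5 = -(x * y) ^ 5

instance (x y z w : ZMod 11) : Decidable (IcosahedralEquations x y z w) :=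
  inferInstanceAs (Decidable (_ ∧ _))

lemma icosahedralDiag_mem : icosahedralDiag ∈ binaryIcosahedral :=
  Subgroup.subset_closure (Set.mem_insert _ _)

lemma icosahedralSymm_mem : icosahedralSymm ∈ binaryIcosahedral :=
  Subgroup.subset_closure (Set.mem_insert_of_mem _ rfl)

lemma neg_one_mem_binaryIcosahedral : -1 ∈ binaryIcosahedral := by
  have : -1 = icosahedralDiag ^ 5 := by decide +kernel
  exact this ▸ pow_mem icosahedralDiag_mem 5

lemma commutator_binaryIcosahedral : commutator binaryIcosahedral = ⊤ := by
  have hd := icosahedralDiag_mem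
  have hs := icosahedralSymm_mem
  apply Subgroup.map_injective binaryIcosahedral.subtype_injective
  rw [Subgroup.map_subtype_commutator, ← MonoidHom.range_eq_map, Subgroup.range_subtype]
  refine le_antisymm (Subgroup.commutator_le_self _) ((Subgroup.closure_le _).2 ?_)
  rintro _ (rfl | rfl)
  · have : icosahedralDiag = ⁅icosahedralSymm * icosahedralDiag, icosahedralSymm⁆ := by
      decide +kernel
    rw [this]
    exact Subgroup.commutator_mem_commutator (mul_mem hs hd) hs
  · have : icosahedralSymm = ⁅icosahedralDiag⁻¹ ^ 2 * icosahedralSymm⁻¹ * icosahedralDiag⁻¹,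
        icosahedralSymm ^ 2⁆ := by
      decide +kernel
    rw [this]
    exact Subgroup.commutator_mem_commutator
      (mul_mem (mul_mem (pow_mem (inv_mem hd) 2) (inv_mem hs)) (inv_mem hd)) (pow_mem hs 2)

lemma icosahedralEquations_mul_diag : ∀ x y z w, IcosahedralEquations x y z w →
    IcosahedralEquations (x * 2) (y * 6) (z * 2) (w * 6) ∧
      IcosahedralEquations (x * 6) (y * 2) (z * 6) (w * 2) := by
  decide +kernel

lemma icosahedralEquations_mul_symm : ∀ x y z w, IcosahedralEquations x y z w →
    IcosahedralEquations (x + y) (x + y * 2) (z + w) (z + w * 2) ∧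
      IcosahedralEquations (x * 2 - y) (y - x) (z * 2 - w) (w - z) := by
  decide +kernel

lemma icosahedralEquations_of_mem {g : SL(2, ZMod 11)} (hg : g ∈ binaryIcosahedral) :
    IcosahedralEquations (g.1 0 0) (g.1 0 1) (g.1 1 0) (g.1 1 1) := by
  induction hg using Subgroup.closure_induction_right with
  | one => decide +kernel
  | mul_right g _ t ht ih =>
    rcases ht with rfl | rfl
    · have h : icosahedralDiag.1 = !![2, 0; 0, 6] := rfl
      simpa [SpecialLinearGroup.val_mul, h, Matrix.mul_apply, Fin.sum_univ_two] using
        (icosahedralEquations_mul_diag _ _ _ _ ih).1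
    · have h : icosahedralSymm.1 = !![1, 1; 1, 2] := rfl
      simpa [SpecialLinearGroup.val_mul, h, Matrix.mul_apply, Fin.sum_univ_two] using
        (icosahedralEquations_mul_symm _ _ _ _ ih).1
  | mul_inv_cancel g _ t ht ih =>
    rcases ht with rfl | rfl
    · have h : icosahedralDiag⁻¹.1 = !![6, 0; 0, 2] := by decide +kernel
      simpa [SpecialLinearGroup.val_mul, h, Matrix.mul_apply, Fin.sum_univ_two] using
        (icosahedralEquations_mul_diag _ _ _ _ ih).2
    · have h : icosahedralSymm⁻¹.1 = !![2, -1; -1, 1] := by decide +kernel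
      simpa [SpecialLinearGroup.val_mul, h, Matrix.mul_apply, Fin.sum_univ_two, sub_eq_add_neg,
        add_comm] using (icosahedralEquations_mul_symm _ _ _ _ ih).2

lemma eq_one_of_trace_eq_two : ∀ x y z w, IcosahedralEquations x y z w → x + w = 2 →
    x = 1 ∧ y = 0 ∧ z = 0 ∧ w = 1 := by
  decide +kernel

lemma eq_one_of_pow_eleven (s : binaryIcosahedral) (hs : s ^ 11 = 1) : s = 1 := by
  have hpow : s.1.1 ^ 11 = 1 := congrArg (fun t : binaryIcosahedral => t.1.1) hs
  have htr := ZMod.trace_pow_card (p := 11) s.1.1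
  rw [hpow, ZMod.pow_card, trace_one, trace_fin_two] at htr
  obtain ⟨h₁, h₂, h₃, h₄⟩ := eq_one_of_trace_eq_two _ _ _ _ (icosahedralEquations_of_mem s.2)
    (by simpa using htr.symm)
  apply Subtype.ext
  apply Subtype.ext
  rw [eta_fin_two s.1.1, h₁, h₂, h₃, h₄]
  exact one_fin_two.symm

/-- Representatives, modulo the diagonal subgroup, of the conjugators in
`exists_conj_eq_icosahedralDiag`. -/
def icosahedralConjugators : List SL(2, ZMod 11) :=
  [1, icosahedralSymm * icosahedralDiag * icosahedralSymm ^ 2, icosahedralSymm, icosahedralSymm ^ 2]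

lemma exists_conjugator : ∀ x y z w, IcosahedralEquations x y z w → x + w = 8 →
    ∃ k ∈ icosahedralConjugators, ∃ i : Fin 5,
      (k * icosahedralDiag ^ i.1).1 * !![x, y; z, w] =
        icosahedralDiag.1 * (k * icosahedralDiag ^ i.1).1 := by
  decide +kernel

lemma exists_conj_eq_icosahedralDiag {g : SL(2, ZMod 11)} (hg : g ∈ binaryIcosahedral)
    (htr : g.1.trace = 8) :
    ∃ s ∈ binaryIcosahedral, s.1 * g.1 = icosahedralDiag.1 * s.1 := by
  have hd := icosahedralDiag_mem
  have hs := icosahedralSymm_mem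
  obtain ⟨k, hk, i, h⟩ := exists_conjugator _ _ _ _ (icosahedralEquations_of_mem hg)
    (by rwa [trace_fin_two] at htr)
  rw [← eta_fin_two] at h
  refine ⟨k * icosahedralDiag ^ i.1, mul_mem ?_ (pow_mem hd _), h⟩
  simp only [icosahedralConjugators, List.mem_cons, List.not_mem_nil, or_false] at hk
  rcases hk with rfl | rfl | rfl | rfl
  exacts [one_mem _, mul_mem (mul_mem hs hd) (pow_mem hs 2), hs, pow_mem hs 2]

lemma isSquare_mul_of_pow_five_eq_one : ∀ a d : ZMod 11, (a * d⁻¹) ^ 5 = 1 → IsSquare (a * d) := by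
  decide +kernel

/-- The normalizer of the binary icosahedral group in `GL(2, 11)` has square determinants. -/
lemma isSquare_det_of_normalizes {M : Matrix (Fin 2) (Fin 2) (ZMod 11)} (hM : M.det ≠ 0)
    (h : ∀ s ∈ binaryIcosahedral, ∃ t ∈ binaryIcosahedral, M * s.1 = t.1 * M) :
    IsSquare M.det := by
  obtain ⟨g, hg, hMg⟩ := h _ icosahedralDiag_mem
  have htr : g.1.trace = 8 := by
    have hg' : g.1 = M * icosahedralDiag.1 * M⁻¹ := by
      rw [hMg, Matrix.mul_assoc, mul_nonsing_inv _ hM.isUnit, Matrix.mul_one]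
    rw [hg', trace_mul_comm, ← Matrix.mul_assoc, nonsing_inv_mul _ hM.isUnit, Matrix.one_mul]
    decide +kernel
  obtain ⟨s, hs, hsg⟩ := exists_conj_eq_icosahedralDiag hg htr
  set N := s.1 * M with hN
  have hdet : N.det = M.det := by rw [hN, det_mul, s.2, one_mul]
  have hNdiag : N * icosahedralDiag.1 = icosahedralDiag.1 * N := by
    rw [hN, Matrix.mul_assoc, hMg, ← Matrix.mul_assoc, hsg, Matrix.mul_assoc]
  obtain ⟨t, ht, hMt⟩ := h _ icosahedralSymm_mem
  have hNt : N * icosahedralSymm.1 = (s * t * s⁻¹).1 * N := by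
    have hinv : s⁻¹.1 * s.1 = 1 := congrArg Subtype.val (inv_mul_cancel s)
    rw [hN, Matrix.mul_assoc, hMt, SpecialLinearGroup.val_mul, SpecialLinearGroup.val_mul,
      Matrix.mul_assoc (s.1 * t.1), ← Matrix.mul_assoc _ s.1, hinv, Matrix.one_mul,
      Matrix.mul_assoc]
  have hq := icosahedralEquations_of_mem (mul_mem (mul_mem hs ht) (inv_mem hs))
  set q := (s * t * s⁻¹).1
  have hD : icosahedralDiag.1 = !![2, 0; 0, 6] := rfl
  have hT : icosahedralSymm.1 = !![1, 1; 1, 2] := rfl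
  rw [hD] at hNdiag
  rw [hT] at hNt
  have h11 : (11 : ZMod 11) = 0 := by decide
  have h₀₁ : N 0 1 = 0 := by
    have := congrFun (congrFun hNdiag 0) 1
    simp [Matrix.mul_apply, Fin.sum_univ_two] at this
    linear_combination 3 * this - N 0 1 * h11
  have h₁₀ : N 1 0 = 0 := by
    have := congrFun (congrFun hNdiag 1) 0
    simp [Matrix.mul_apply, Fin.sum_univ_two] at this
    linear_combination -3 * this - N 1 0 * h11
  have hdet' : N.det = N 0 0 * N 1 1 := by rw [det_fin_two, h₀₁, zero_mul, sub_zero]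
  rw [← hdet, hdet'] at hM ⊢
  obtain ⟨ha, hd⟩ := mul_ne_zero_iff.1 hM
  apply isSquare_mul_of_pow_five_eq_one
  rw [← Matrix.ext_iff] at hNt
  simp [Matrix.mul_apply, Fin.sum_univ_two, Fin.forall_fin_two, h₀₁, h₁₀] at hNt
  obtain ⟨⟨h₁, h₂⟩, h₃, h₄⟩ := hNt
  have hq₀₀ : q 0 0 = 1 := mul_right_cancel₀ ha (by rw [← h₁, one_mul])
  have hq₁₁ : q 1 1 = 2 := mul_right_cancel₀ hd (by rw [← h₄, mul_comm])
  have hq₀₁ : q 0 1 = N 0 0 * (N 1 1)⁻¹ := (eq_mul_inv_iff_mul_eq₀ hd).2 h₂.symm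
  have hq₁₀ : q 1 0 = N 1 1 * (N 0 0)⁻¹ := (eq_mul_inv_iff_mul_eq₀ ha).2 h₃.symm
  have hqq : N 0 0 * (N 1 1)⁻¹ * (N 1 1 * (N 0 0)⁻¹) = 1 := by field_simp
  have h := hq.2.1
  rw [hq₀₀, hq₁₁, hq₀₁, hq₁₀, hqq, one_mul] at h
  rw [h]
  decide

end BinaryIcosahedral

section CentralProduct

variable {K₁ K₂ Z P P' : Type*} [Group P] [Group P'] [Group K₁] [Group K₂] [CommGroup Z]

/-- `P` is the central product of `K₁` and `K₂` in which the images of `ι₁` and `ι₂` are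
identified. -/
structure IsAmalgam (ι₁ : Z →* K₁) (ι₂ : Z →* K₂) (f₁ : K₁ →* P) (f₂ : K₂ →* P) : Prop where
  isCentralProduct : IsCentralProduct f₁.range f₂.range
  eq_iff : ∀ a b, f₁ a = f₂ b ↔ ∃ z, ι₁ z = a ∧ ι₂ z = b

namespace IsAmalgam

variable {ι₁ : Z →* K₁} {ι₂ : Z →* K₂} {f₁ : K₁ →* P} {f₂ : K₂ →* P}
  {f₁' : K₁ →* P'} {f₂' : K₂ →* P'}

lemma injective_left (h : IsAmalgam ι₁ ι₂ f₁ f₂) (hι : Function.Injective ι₂) :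
    Function.Injective f₁ := by
  refine (injective_iff_map_eq_one f₁).2 fun a ha => ?_
  obtain ⟨z, rfl, hz⟩ := (h.eq_iff a 1).1 (by rw [ha, map_one])
  rw [(map_eq_one_iff ι₂ hι).1 hz, map_one]

lemma injective_right (h : IsAmalgam ι₁ ι₂ f₁ f₂) (hι : Function.Injective ι₁) :
    Function.Injective f₂ := by
  refine (injective_iff_map_eq_one f₂).2 fun b hb => ?_
  obtain ⟨z, hz, rfl⟩ := (h.eq_iff 1 b).1 (by rw [hb, map_one])
  rw [(map_eq_one_iff ι₁ hι).1 hz, map_one]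

lemma surjective (h : IsAmalgam ι₁ ι₂ f₁ f₂) :
    Function.Surjective fun x : K₁ × K₂ => f₁ x.1 * f₂ x.2 := fun g => by
  obtain ⟨_, ⟨a, rfl⟩, _, ⟨b, rfl⟩, rfl⟩ := h.isCentralProduct.exists_eq_mul g
  exact ⟨(a, b), rfl⟩

lemma commute (h : IsAmalgam ι₁ ι₂ f₁ f₂) (a : K₁) (b : K₂) : f₁ a * f₂ b = f₂ b * f₁ a :=
  h.isCentralProduct.commute _ ⟨a, rfl⟩ _ ⟨b, rfl⟩

lemma mul_eq_mul_iff (h : IsAmalgam ι₁ ι₂ f₁ f₂) (a a' : K₁) (b b' : K₂) :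
    f₁ a * f₂ b = f₁ a' * f₂ b' ↔ ∃ z, ι₁ z = a'⁻¹ * a ∧ ι₂ z = b' * b⁻¹ := by
  rw [← h.eq_iff, map_mul, map_mul, map_inv, map_inv, inv_mul_eq_iff_eq_mul, ← mul_assoc,
    eq_mul_inv_iff_mul_eq]

/-- Inverting the first factor identifies an amalgam with the oppositely glued one. -/
lemma exists_equiv_inv_left (hι : ∀ z, ι₁ z ∈ Subgroup.center K₁) (h : IsAmalgam ι₁ ι₂ f₁ f₂)
    (h' : IsAmalgam ι₁ (ι₂.comp invMonoidHom) f₁' f₂') :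
    ∃ e : P ≃ P', ∀ a b, e (f₁ a * f₂ b) = f₁' a⁻¹ * f₂' b := by
  have key (a a' : K₁) (b b' : K₂) :
      f₁' a⁻¹ * f₂' b = f₁' a'⁻¹ * f₂' b' ↔ f₁ a * f₂ b = f₁ a' * f₂ b' := by
    rw [h.mul_eq_mul_iff, h'.mul_eq_mul_iff, inv_inv]
    have hswap (z : Z) : (ι₁ z)⁻¹ = a' * a⁻¹ ↔ ι₁ z = a'⁻¹ * a := by
      rw [inv_eq_iff_eq_inv, _root_.mul_inv_rev, inv_inv, eq_mul_inv_iff_mul_eq,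
        ← Subgroup.mem_center_iff.1 (hι z) a', eq_inv_mul_iff_mul_eq]
    rw [(Equiv.inv Z).exists_congr_left]
    simp [hswap]
  have hf : Function.Surjective fun x : K₁ × K₂ => f₁' x.1⁻¹ * f₂' x.2 := fun g => by
    obtain ⟨x, rfl⟩ := h'.surjective g
    exact ⟨(x.1⁻¹, x.2), by simp⟩
  have hsurj := Function.surjInv_eq h.surjective
  refine ⟨Equiv.ofBijective (fun g => f₁' (Function.surjInv h.surjective g).1⁻¹ *
    f₂' (Function.surjInv h.surjective g).2) ⟨fun x y hxy => ?_, fun g => ?_⟩, fun a b => ?_⟩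
  · have := (key _ _ _ _).1 hxy
    rwa [hsurj, hsurj] at this
  · obtain ⟨x, rfl⟩ := hf g
    exact ⟨f₁ x.1 * f₂ x.2, (key _ _ _ _).2 (hsurj _)⟩
  · exact (key _ _ _ _).2 (hsurj _)

lemma range_map_eq [Finite K₁] [Finite K₂] {κ₁ : Z →* K₁} {κ₂ : Z →* K₂}
    (h : IsAmalgam ι₁ ι₂ f₁ f₂) (h' : IsAmalgam κ₁ κ₂ f₁' f₂')
    (hι₁ : Function.Injective ι₁) (hι₂ : Function.Injective ι₂)
    (hκ₁ : Function.Injective κ₁) (hκ₂ : Function.Injective κ₂)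
    (hK₁ : commutator K₁ = ⊤) (hK₂ : commutator K₂ = ⊤)
    (hind₁ : CentrallyIndecomposable K₁) (hind₂ : CentrallyIndecomposable K₂)
    (hcard : Nat.card K₁ < Nat.card K₂) (φ : P ≃* P') :
    f₁.range.map φ.toMonoidHom = f₁'.range ∧ f₂.range.map φ.toMonoidHom = f₂'.range := by
  have : Finite P' := Finite.of_surjective _ h'.surjective
  have hinj₁ : Function.Injective (φ.toMonoidHom.comp f₁) :=
    φ.injective.comp (h.injective_left hι₂)
  have hinj₂ : Function.Injective (φ.toMonoidHom.comp f₂) :=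
    φ.injective.comp (h.injective_right hι₁)
  have e₁ := MonoidHom.ofInjective hinj₁
  have e₂ := MonoidHom.ofInjective hinj₂
  have e₁' := MonoidHom.ofInjective (h'.injective_left hκ₂)
  have e₂' := MonoidHom.ofInjective (h'.injective_right hκ₁)
  have hcp := h.isCentralProduct.map (f := φ.toMonoidHom) φ.surjective
  rw [← MonoidHom.range_comp, ← MonoidHom.range_comp] at hcp ⊢
  refine hcp.unique h'.isCentralProduct (commutator_range hK₁ _) (commutator_range hK₂ _)
    (hind₁.of_mulEquiv e₁) (hind₂.of_mulEquiv e₂) ?_ ?_ ?_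
  · exact Nat.card_congr (e₁.symm.trans e₁').toEquiv
  · exact Nat.card_congr (e₂.symm.trans e₂').toEquiv
  · rwa [← Nat.card_congr e₁.toEquiv, ← Nat.card_congr e₂.toEquiv]

end IsAmalgam

lemma exists_isAmalgam {K₁ K₂ : Type} [Group K₁] [Group K₂] {ι₁ : Z →* K₁} {ι₂ : Z →* K₂}
    (h₁ : ∀ z, ι₁ z ∈ Subgroup.center K₁) (h₂ : ∀ z, ι₂ z ∈ Subgroup.center K₂) :
    ∃ (P : Type) (_ : Group P) (f₁ : K₁ →* P) (f₂ : K₂ →* P), IsAmalgam ι₁ ι₂ f₁ f₂ := by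
  let D : Subgroup (K₁ × K₂) := (ι₁.prod (ι₂.comp (invMonoidHom : Z →* Z))).range
  have hD : D.Normal := by
    constructor
    rintro _ ⟨z, rfl⟩ g
    refine ⟨z, Prod.ext ?_ ?_⟩
    · simp [Subgroup.mem_center_iff.1 (h₁ z)]
    · simp [Subgroup.mem_center_iff.1 (inv_mem (h₂ z))]
  refine ⟨(K₁ × K₂) ⧸ D, inferInstance, (QuotientGroup.mk' D).comp (.inl K₁ K₂),
    (QuotientGroup.mk' D).comp (.inr K₁ K₂), ⟨?_, ?_⟩, fun a b => ?_⟩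
  · rintro _ ⟨a, rfl⟩ _ ⟨b, rfl⟩
    simp only [MonoidHom.comp_apply, ← map_mul]
    simp
  · intro g
    obtain ⟨⟨a, b⟩, rfl⟩ := QuotientGroup.mk'_surjective D g
    refine ⟨_, ⟨a, rfl⟩, _, ⟨b, rfl⟩, ?_⟩
    simp only [MonoidHom.comp_apply, ← map_mul]
    simp
  · simp only [MonoidHom.comp_apply, QuotientGroup.mk'_apply]
    rw [eq_comm, QuotientGroup.eq]
    simp [D, Prod.ext_iff, inv_eq_iff_eq_inv, eq_comm]

/-- An isomorphism matching the images of two embeddings lifts to an automorphism. -/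
lemma MulEquiv.exists_lift_of_range_map_eq {K : Type*} [Group K] {f : K →* P} {f' : K →* P'}
    (hf : Function.Injective f) (hf' : Function.Injective f') (φ : P ≃* P')
    (h : f.range.map φ.toMonoidHom = f'.range) : ∃ α : K ≃* K, ∀ a, f' (α a) = φ (f a) := by
  have hφf : Function.Injective (φ.toMonoidHom.comp f) := φ.injective.comp hf
  rw [← MonoidHom.range_comp] at h
  refine ⟨((MonoidHom.ofInjective hφf).trans (MulEquiv.subgroupCongr h)).trans
    (MonoidHom.ofInjective hf').symm, fun a => ?_⟩
  have := (MonoidHom.ofInjective hf').apply_symm_apply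
    (MulEquiv.subgroupCongr h (MonoidHom.ofInjective hφf a))
  exact congrArg Subtype.val this

end CentralProduct

/-- The extension by the binary icosahedral group of a Heisenberg group and `n` natural modules. -/
abbrev IcosahedralExtension (n : ℕ) : Type := HeisenbergExtension binaryIcosahedral n

namespace IcosahedralExtension

lemma commutator_eq_top (n : ℕ) : commutator (IcosahedralExtension n) = ⊤ :=
  HeisenbergExtension.commutator_eq_top (by decide) neg_one_mem_binaryIcosahedral
    commutator_binaryIcosahedral

lemma centrallyIndecomposable (n : ℕ) : CentrallyIndecomposable (IcosahedralExtension n) :=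
  HeisenbergExtension.centrallyIndecomposable (by decide) neg_one_mem_binaryIcosahedral
    commutator_binaryIcosahedral

lemma exists_isSquare_of_mulEquiv {n : ℕ} (α : IcosahedralExtension n ≃* IcosahedralExtension n) :
    ∃ m : ZMod 11, m ≠ 0 ∧ IsSquare m ∧
      ∀ c : ZMod 11, α (HeisenbergExtension.ofCenter (.ofAdd c)) =
        HeisenbergExtension.ofCenter (.ofAdd (m * c)) := by
  obtain ⟨M, hM, hnorm, hα⟩ := HeisenbergExtension.exists_matrix_of_mulEquiv (by decide)
    neg_one_mem_binaryIcosahedral eq_one_of_pow_eleven α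
  exact ⟨M.det, hM, isSquare_det_of_normalizes hM hnorm, hα⟩

lemma isEmpty_mulEquiv_twist {m n : ℕ} (hmn : m < n) {P P' : Type*} [Group P] [Group P']
    {f₁ : IcosahedralExtension m →* P} {f₂ : IcosahedralExtension n →* P}
    {f₁' : IcosahedralExtension m →* P'} {f₂' : IcosahedralExtension n →* P'}
    (h : IsAmalgam HeisenbergExtension.ofCenter HeisenbergExtension.ofCenter f₁ f₂)
    (h' : IsAmalgam HeisenbergExtension.ofCenter
      (HeisenbergExtension.ofCenter.comp invMonoidHom) f₁' f₂') : IsEmpty (P ≃* P') := by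
  refine ⟨fun φ => ?_⟩
  have hι (k : ℕ) := HeisenbergExtension.ofCenter_injective (S := binaryIcosahedral) (n := k)
  have hκ := (hι n).comp (inv_injective (G := Multiplicative (ZMod 11)))
  obtain ⟨hφ₁, hφ₂⟩ := h.range_map_eq h' (hι m) (hι n) (hι m) hκ (commutator_eq_top m)
    (commutator_eq_top n) (centrallyIndecomposable m) (centrallyIndecomposable n)
    (HeisenbergExtension.card_strictMono hmn) φ
  obtain ⟨α₁, hα₁⟩ := φ.exists_lift_of_range_map_eq (h.injective_left (hι n))
    (h'.injective_left hκ) hφ₁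
  obtain ⟨α₂, hα₂⟩ := φ.exists_lift_of_range_map_eq (h.injective_right (hι m))
    (h'.injective_right (hι m)) hφ₂
  obtain ⟨m₁, hm₁, hsq₁, hc₁⟩ := exists_isSquare_of_mulEquiv α₁
  obtain ⟨m₂, hm₂, hsq₂, hc₂⟩ := exists_isSquare_of_mulEquiv α₂
  have hglue := (h.eq_iff _ _).2 ⟨.ofAdd (1 : ZMod 11), rfl, rfl⟩
  have := congrArg φ hglue
  rw [← hα₁, ← hα₂, hc₁, hc₂, h'.eq_iff] at this
  obtain ⟨z, hz₁, hz₂⟩ := this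
  have hz₁' : z.toAdd = m₁ := by simpa using congrArg Multiplicative.toAdd (hι m hz₁)
  have hz₂' : -z.toAdd = m₂ := by simpa using congrArg Multiplicative.toAdd (hι n hz₂)
  have hnonsquare : ∀ a : ZMod 11, a ≠ 0 → IsSquare a → ¬ IsSquare (-a) := by decide +kernel
  subst hz₁' hz₂'
  exact hnonsquare _ hm₁ hsq₁ hsq₂

end IcosahedralExtension

end Auxiliary

/-- Proposition 7.11: there is a finite group `G` which is the central product of
two perfect, centrally indecomposable characteristic subgroups `Q₁, Q₂`, such
that the group `(G, ∘)` obtained by replacing `Q₁` with its opposite is not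
isomorphic to `G`, while `Q₁` and `Q₂` remain characteristic in `(G, ∘)`. -/
theorem exists_central_product_with_nonisomorphic_twist :
    ∃ (G : Type) (_ : Group G) (_ : Finite G) (Q₁ Q₂ : Subgroup G)
      (mul' : G → G → G),
      -- the Qᵢ are perfect and centrally indecomposable
      (⁅Q₁, Q₁⁆ = Q₁ ∧ ⁅Q₂, Q₂⁆ = Q₂) ∧
      (CentrallyIndecomposable Q₁ ∧ CentrallyIndecomposable Q₂) ∧
      -- G is the central product of Q₁ and Q₂
      (∀ a ∈ Q₁, ∀ b ∈ Q₂, a * b = b * a) ∧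
      (∀ g : G, ∃ a ∈ Q₁, ∃ b ∈ Q₂, g = a * b) ∧
      -- (1) Q₁ and Q₂ are characteristic in G
      (Q₁.Characteristic ∧ Q₂.Characteristic) ∧
      -- (2) ∘ is a group operation with the same identity ...
      (∀ x y z : G, mul' (mul' x y) z = mul' x (mul' y z)) ∧
      (∀ x : G, mul' 1 x = x ∧ mul' x 1 = x) ∧
      (∀ x : G, ∃ y : G, mul' x y = 1 ∧ mul' y x = 1) ∧
      -- ... obtained from G by replacing Q₁ with its opposite
      (∀ a ∈ Q₁, ∀ b ∈ Q₂, ∀ a' ∈ Q₁, ∀ b' ∈ Q₂,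
        mul' (a * b) (a' * b') = (a' * a) * (b * b')) ∧
      -- (3) (G, ∘) is not isomorphic to G
      (¬ ∃ f : G ≃ G, ∀ x y : G, f (mul' x y) = f x * f y) ∧
      -- (4) Q₁ and Q₂ are still characteristic in (G, ∘)
      (∀ f : G ≃ G, (∀ x y : G, f (mul' x y) = mul' (f x) (f y)) →
        f '' (Q₁ : Set G) = (Q₁ : Set G) ∧ f '' (Q₂ : Set G) = (Q₂ : Set G)) := by
  let ι (k : ℕ) : Multiplicative (ZMod 11) →* IcosahedralExtension k :=
    HeisenbergExtension.ofCenter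
  have hcen (k : ℕ) (z) : ι k z ∈ Subgroup.center _ := HeisenbergExtension.ofCenter_mem_center z
  have hι (k : ℕ) : Function.Injective (ι k) := HeisenbergExtension.ofCenter_injective
  have hκ : Function.Injective ((ι 1).comp invMonoidHom) := (hι 1).comp inv_injective
  obtain ⟨G, _, f₁, f₂, h⟩ := exists_isAmalgam (hcen 0) (hcen 1)
  obtain ⟨G', _, f₁', f₂', h'⟩ := exists_isAmalgam (ι₂ := (ι 1).comp invMonoidHom) (hcen 0)
    fun z => hcen 1 z⁻¹
  obtain ⟨e, he⟩ := h.exists_equiv_inv_left (hcen 0) h'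
  have hperf := IcosahedralExtension.commutator_eq_top
  have hind := IcosahedralExtension.centrallyIndecomposable
  have hcard : Nat.card (IcosahedralExtension 0) < Nat.card (IcosahedralExtension 1) :=
    HeisenbergExtension.card_strictMono Nat.zero_lt_one
  have hchar (φ : G ≃* G) := h.range_map_eq h (hι 0) (hι 1) (hι 0) (hι 1) (hperf 0) (hperf 1)
    (hind 0) (hind 1) hcard φ
  have hchar' (φ : G' ≃* G') := h'.range_map_eq h' (hι 0) hκ (hι 0) hκ (hperf 0) (hperf 1)
    (hind 0) (hind 1) hcard φ
  have he_one : e 1 = 1 := by simpa using he 1 1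
  have he_left : e '' f₁.range = f₁'.range := by
    have hcomp : e ∘ f₁ = f₁' ∘ Inv.inv := funext fun a => by simpa using he a 1
    rw [MonoidHom.coe_range, MonoidHom.coe_range, ← Set.range_comp, hcomp]
    exact inv_surjective.range_comp f₁'
  have he_right : e '' f₂.range = f₂'.range := by
    have hcomp : e ∘ f₂ = f₂' := funext fun b => by simpa using he 1 b
    rw [MonoidHom.coe_range, MonoidHom.coe_range, ← Set.range_comp, hcomp]
  refine ⟨G, _, Finite.of_surjective _ h.surjective, f₁.range, f₂.range,
    fun x y => e.symm (e x * e y), ⟨commutator_range (hperf 0) f₁, commutator_range (hperf 1) f₂⟩,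
    ⟨(hind 0).of_mulEquiv (MonoidHom.ofInjective (h.injective_left (hι 1))),
      (hind 1).of_mulEquiv (MonoidHom.ofInjective (h.injective_right (hι 0)))⟩,
    h.isCentralProduct.commute, h.isCentralProduct.exists_eq_mul,
    ⟨Subgroup.characteristic_iff_map_eq.2 fun φ => (hchar φ).1,
      Subgroup.characteristic_iff_map_eq.2 fun φ => (hchar φ).2⟩,
    fun x y z => by simp [mul_assoc], fun x => by simp [he_one],
    fun x => ⟨e.symm (e x)⁻¹, by simp [← he_one], by simp [← he_one]⟩, ?_, ?_, fun f hf => ?_⟩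
  · rintro _ ⟨a, rfl⟩ _ ⟨b, rfl⟩ _ ⟨a', rfl⟩ _ ⟨b', rfl⟩
    rw [Equiv.symm_apply_eq, he, he, ← map_mul, ← map_mul, he, mul_inv_rev, map_mul, map_mul,
      mul_assoc, ← mul_assoc (f₂' b), ← h'.commute]
    simp only [mul_assoc]
  · rintro ⟨f, hf⟩
    refine (IcosahedralExtension.isEmpty_mulEquiv_twist Nat.zero_lt_one h h').false
      (MulEquiv.mk' (e.symm.trans f) fun x y => ?_).symm
    simpa using hf (e.symm x) (e.symm y)
  · let φ : G' ≃* G' := MulEquiv.mk' ((e.symm.trans f).trans e) fun x y => by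
      simpa using congrArg e (hf (e.symm x) (e.symm y))
    have hφ (A : Set G) : φ '' (e '' A) = e '' (f '' A) := by
      rw [Set.image_image, Set.image_image]
      exact Set.image_congr fun a _ => congrArg (fun x => e (f x)) (e.symm_apply_apply a)
    refine ⟨e.injective.image_injective ?_, e.injective.image_injective ?_⟩
    · rw [← hφ, he_left]
      exact congrArg SetLike.coe (hchar' φ).1
    · rw [← hφ, he_right]
      exact congrArg SetLike.coe (hchar' φ).2
end

section
/- For every prime p with p ≡ 1 (mod 3) there exists a finite group L_p such that: (1) L_p is perfect; (2) L_p is centrally indecomposable; (3) the center Z(L_p) has order 3; (4) every automorphism of L_p fixes Z(L_p) pointwise; and (5) for distinct primes p ≠ q (both ≡ 1 mod 3), the quotients L_p/Z(L_p) and L_q/Z(L_q) are not isomorphic. -/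
namespace HoltFamily
open Finset

/-- The group of triples `(w, d, s)`, where `(d, s)` acts on vectors `w : S → ZMod p` as the
monomial matrix with coefficients `χ ∘ d` and permutation `s` (left translation); the entries of
`d` add up to zero. -/
@[ext]
structure HoltGroup (S : Type) [Group S] [Fintype S] (p : ℕ) (χ : AddChar (ZMod 9) (ZMod p)) where
  w : S → ZMod p
  d : S → ZMod 9
  s : S
  sum_d : ∑ t, d t = 0

namespace HoltGroup

variable {S : Type} [Group S] [Fintype S] {p : ℕ} {χ : AddChar (ZMod 9) (ZMod p)}

lemma sum_translate (d : S → ZMod 9) (s : S) : ∑ t, d (s * t) = ∑ t, d t :=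
  Equiv.sum_comp (Equiv.mulLeft s) d

instance : Mul (HoltGroup S p χ) where
  mul g h :=
    { w := fun t => g.w t + χ (g.d t) * h.w (g.s⁻¹ * t)
      d := fun t => g.d t + h.d (g.s⁻¹ * t)
      s := g.s * h.s
      sum_d := by rw [sum_add_distrib, sum_translate, g.sum_d, h.sum_d, add_zero] }

instance : One (HoltGroup S p χ) := ⟨⟨0, 0, 1, by simp⟩⟩

instance : Inv (HoltGroup S p χ) where
  inv g :=
    { w := fun t => -(χ (-g.d (g.s * t)) * g.w (g.s * t))
      d := fun t => -g.d (g.s * t)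
      s := g.s⁻¹
      sum_d := by rw [sum_neg_distrib, sum_translate, g.sum_d, neg_zero] }

@[simp] lemma mul_w (g h : HoltGroup S p χ) (t : S) :
    (g * h).w t = g.w t + χ (g.d t) * h.w (g.s⁻¹ * t) := rfl
@[simp] lemma mul_d (g h : HoltGroup S p χ) (t : S) :
    (g * h).d t = g.d t + h.d (g.s⁻¹ * t) := rfl
@[simp] lemma mul_s (g h : HoltGroup S p χ) : (g * h).s = g.s * h.s := rfl
@[simp] lemma one_w : (1 : HoltGroup S p χ).w = 0 := rfl
@[simp] lemma one_d : (1 : HoltGroup S p χ).d = 0 := rfl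
@[simp] lemma one_s : (1 : HoltGroup S p χ).s = 1 := rfl
lemma inv_w (g : HoltGroup S p χ) (t : S) :
    g⁻¹.w t = -(χ (-g.d (g.s * t)) * g.w (g.s * t)) := rfl
lemma inv_d (g : HoltGroup S p χ) (t : S) : g⁻¹.d t = -g.d (g.s * t) := rfl
lemma inv_s (g : HoltGroup S p χ) : g⁻¹.s = g.s⁻¹ := rfl

instance : Group (HoltGroup S p χ) :=
  Group.ofLeftAxioms
    (fun a b c => by
      ext t
      · simp [AddChar.map_add_eq_mul, mul_assoc]; ring
      · simp [mul_assoc, add_assoc]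
      · simp [mul_assoc])
    (fun a => by ext t <;> simp)
    (fun a => by ext t <;> simp [inv_w, inv_d, inv_s])

instance [NeZero p] : Finite (HoltGroup S p χ) := by
  refine Finite.of_injective
    (fun g : HoltGroup S p χ => (⟨g.w, g.d, g.s⟩ : (S → ZMod p) × (S → ZMod 9) × S)) ?_
  intro g h e
  simp only [Prod.mk.injEq] at e
  exact HoltGroup.ext e.1 e.2.1 e.2.2

/-- The projection onto the permuting group. -/
def proj : HoltGroup S p χ →* S where
  toFun := s
  map_one' := rfl
  map_mul' _ _ := rfl

/-- The inclusion of the complement `S`. -/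
def incl : S →* HoltGroup S p χ where
  toFun u := ⟨0, 0, u, by simp⟩
  map_one' := rfl
  map_mul' a b := by ext <;> simp

/-- The element with given vector part. -/
def vec (v : S → ZMod p) : HoltGroup S p χ := ⟨v, 0, 1, by simp⟩

/-- The element with given diagonal part. -/
def diag (d : S → ZMod 9) (h : ∑ t, d t = 0) : HoltGroup S p χ := ⟨0, d, 1, h⟩

/-- The linear action on vectors. -/
def act (g : HoltGroup S p χ) (v : S → ZMod p) : S → ZMod p :=
  fun t => χ (g.d t) * v (g.s⁻¹ * t)

@[simp] lemma incl_w (u : S) : (incl u : HoltGroup S p χ).w = 0 := rfl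
@[simp] lemma incl_d (u : S) : (incl u : HoltGroup S p χ).d = 0 := rfl
@[simp] lemma incl_s (u : S) : (incl u : HoltGroup S p χ).s = u := rfl
@[simp] lemma vec_w (v : S → ZMod p) : (vec v : HoltGroup S p χ).w = v := rfl
@[simp] lemma vec_d (v : S → ZMod p) : (vec v : HoltGroup S p χ).d = 0 := rfl
@[simp] lemma vec_s (v : S → ZMod p) : (vec v : HoltGroup S p χ).s = 1 := rfl
@[simp] lemma diag_w (d : S → ZMod 9) (h) : (diag d h : HoltGroup S p χ).w = 0 := rfl
@[simp] lemma diag_d (d : S → ZMod 9) (h) : (diag d h : HoltGroup S p χ).d = d := rfl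
@[simp] lemma diag_s (d : S → ZMod 9) (h) : (diag d h : HoltGroup S p χ).s = 1 := rfl

lemma mul_vec (g : HoltGroup S p χ) (v : S → ZMod p) : g * vec v = vec (act g v) * g := by
  ext t <;> simp [act, add_comm]

lemma vec_mul_vec (u v : S → ZMod p) :
    (vec u * vec v : HoltGroup S p χ) = vec (u + v) := by
  ext t <;> simp

lemma vec_pow (v : S → ZMod p) (n : ℕ) : (vec v : HoltGroup S p χ) ^ n = vec (n • v) := by
  induction n with
  | zero => ext t <;> simp
  | succ n ih => rw [pow_succ, ih, vec_mul_vec, succ_nsmul]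

lemma vec_injective : Function.Injective (vec : (S → ZMod p) → HoltGroup S p χ) :=
  fun _ _ e => congrArg w e

lemma pow_s_and_pow_d {g : HoltGroup S p χ} (hg : g.s = 1) (n : ℕ) :
    (g ^ n).s = 1 ∧ (g ^ n).d = n • g.d := by
  induction n with
  | zero => simp
  | succ n ih =>
    rw [pow_succ]
    refine ⟨by simp [ih.1, hg], ?_⟩
    funext t
    simp [ih.1, ih.2, add_mul]

lemma eq_vec {g : HoltGroup S p χ} (hd : g.d = 0) (hs : g.s = 1) : g = vec g.w :=
  HoltGroup.ext rfl hd hs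

lemma pow_s (g : HoltGroup S p χ) (n : ℕ) : (g ^ n).s = g.s ^ n := map_pow proj g n

lemma pow_eq_one (g : HoltGroup S p χ) : g ^ (Fintype.card S * 9 * p) = 1 := by
  have h1 : (g ^ Fintype.card S).s = 1 := by rw [pow_s, pow_card_eq_one]
  obtain ⟨h2, h3⟩ := pow_s_and_pow_d h1 9
  have h4 : ((g ^ Fintype.card S) ^ 9).d = 0 := by
    rw [h3]; funext t
    simp only [Pi.smul_apply, nsmul_eq_mul, Pi.zero_apply]
    rw [show ((9 : ℕ) : ZMod 9) = 0 from rfl, zero_mul]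
  rw [pow_mul, pow_mul, eq_vec h4 h2, vec_pow]
  ext t <;> simp

lemma pow_p_eq_one_iff (hp : (Fintype.card S * 9).Coprime p) (g : HoltGroup S p χ) :
    g ^ p = 1 ↔ g.d = 0 ∧ g.s = 1 := by
  constructor
  · intro h
    have h9 : Nat.Coprime 9 p := Nat.Coprime.coprime_dvd_left (Dvd.intro_left _ rfl) hp
    have hS : (Fintype.card S).Coprime p := Nat.Coprime.coprime_dvd_left (Dvd.intro _ rfl) hp
    have hs : g.s = 1 := by
      have h1 : g.s ^ p = 1 := by rw [← pow_s, h]; rfl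
      have h2 := pow_gcd_eq_one.2 ⟨pow_card_eq_one (x := g.s), h1⟩
      rwa [hS, pow_one] at h2
    refine ⟨?_, hs⟩
    have h1 := (pow_s_and_pow_d hs p).2
    rw [h] at h1
    funext t
    have h2 : (p : ZMod 9) * g.d t = 0 := by simpa using (congrFun h1 t).symm
    have hu : IsUnit (p : ZMod 9) := (ZMod.isUnit_iff_coprime p 9).2 h9.symm
    exact (hu.mul_right_eq_zero).1 h2
  · rintro ⟨hd, hs⟩
    rw [eq_vec hd hs, vec_pow]
    ext t <;> simp

/-- The difference of two coordinate vectors. -/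
def edge [DecidableEq S] (u : S) : HoltGroup S p χ :=
  diag (Pi.single u 1 - Pi.single 1 1) (by simp)

lemma diag_mul_diag (d e : S → ZMod 9) (hd he) :
    (diag d hd * diag e he : HoltGroup S p χ) =
      diag (d + e) (by simp [sum_add_distrib, hd, he]) := by
  ext t <;> simp

lemma s_eq_one_and_d_const [Nontrivial S] [DecidableEq S] {h : HoltGroup S p χ}
    (hs : ∀ g, (h * g).d = (g * h).d) : h.s = 1 ∧ ∀ t, h.d t = h.d 1 := by
  have h1 : h.s = 1 := by
    by_contra hne
    obtain ⟨u, hu⟩ := exists_ne (1 : S)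
    have := congrFun (hs (edge u)) 1
    have e1 : h.s⁻¹ ≠ 1 := by simpa using hne
    simp only [mul_d, edge, diag_d, Pi.sub_apply, diag_s, mul_one, inv_one, Pi.single_apply,
      hu.symm, e1, if_true, if_false, sub_zero, zero_sub] at this
    split_ifs at this
    · have h2 : (2 : ZMod 9) = 0 := by linear_combination this
      exact absurd h2 (by decide)
    · have h2 : (1 : ZMod 9) = 0 := by linear_combination this
      exact absurd h2 (by decide)
  refine ⟨h1, fun t => ?_⟩
  have := congrFun (hs (incl t)) t
  simpa [h1] using this

/-- The diagonal element with constant entry `c`. -/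
def scalar (h9 : (Fintype.card S : ZMod 9) = 0) (c : ZMod 9) : HoltGroup S p χ :=
  diag (fun _ => c) (by simp [h9])

@[simp] lemma scalar_w (h9 : (Fintype.card S : ZMod 9) = 0) (c : ZMod 9) :
    (scalar h9 c : HoltGroup S p χ).w = 0 := rfl
@[simp] lemma scalar_d (h9 : (Fintype.card S : ZMod 9) = 0) (c : ZMod 9) :
    (scalar h9 c : HoltGroup S p χ).d = fun _ => c := rfl
@[simp] lemma scalar_s (h9 : (Fintype.card S : ZMod 9) = 0) (c : ZMod 9) :
    (scalar h9 c : HoltGroup S p χ).s = 1 := rfl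

lemma scalar_pow (h9 : (Fintype.card S : ZMod 9) = 0) (c : ZMod 9) (n : ℕ) :
    (scalar h9 c : HoltGroup S p χ) ^ n = scalar h9 (n • c) := by
  induction n with
  | zero => ext t <;> simp
  | succ n ih => rw [pow_succ, ih]; ext t <;> simp [add_mul]

lemma act_scalar (h9 : (Fintype.card S : ZMod 9) = 0) (c : ZMod 9) (v : S → ZMod p) :
    act (scalar h9 c : HoltGroup S p χ) v = χ c • v := by
  funext t; simp [act]

lemma eq_vec_mul {x y : HoltGroup S p χ} (hd : x.d = y.d) (hs : x.s = y.s) :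
    x = vec (x.w - y.w) * y := by
  ext t <;> simp [hd, hs]

lemma three_mul_eq_zero (hχ : χ 1 ≠ 1) {c : ZMod 9} (hc : χ c = 1) : 3 * c = 0 := by
  by_contra h
  have key : ∀ c : ZMod 9, 3 * c ≠ 0 → ∃ n : Fin 9, n.val • c = 1 := by decide
  obtain ⟨n, hn⟩ := key c h
  apply hχ
  rw [← hn, AddChar.map_nsmul_eq_pow, hc, one_pow]

lemma char_ne_zero [Fact p.Prime] (c : ZMod 9) : χ c ≠ 0 := by
  intro h
  have := AddChar.map_add_eq_mul χ c (-c)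
  rw [h] at this
  simp at this

lemma act_mul (g h : HoltGroup S p χ) (v : S → ZMod p) :
    act (g * h) v = act g (act h v) := by
  funext t; simp [act, AddChar.map_add_eq_mul, mul_assoc]

/-- An automorphism preserves the set of elements of order dividing `p`, hence the vectors. -/
lemma exists_map_vec (hp : (Fintype.card S * 9).Coprime p) (β : MulAut (HoltGroup S p χ))
    (v : S → ZMod p) : ∃ u, β (vec v) = vec u := by
  have h : β (vec v) ^ p = 1 := by
    rw [← map_pow, (pow_p_eq_one_iff hp _).2 ⟨rfl, rfl⟩, map_one]
  obtain ⟨h1, h2⟩ := (pow_p_eq_one_iff hp _).1 h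
  exact ⟨_, eq_vec h1 h2⟩

lemma abelianization_of_incl (hS : commutator S = ⊤) (s : S) :
    Abelianization.of (incl s : HoltGroup S p χ) = 1 := by
  have : s ∈ commutator S := hS ▸ Subgroup.mem_top s
  exact Abelianization.commutator_subset_ker (Abelianization.of.comp incl) this

section Perfect

variable [Fact p.Prime]

lemma abelianization_of_vec (h9 : (Fintype.card S : ZMod 9) = 0) (hχ : χ 1 ≠ 1)
    (v : S → ZMod p) : Abelianization.of (vec v : HoltGroup S p χ) = 1 := by
  have key (u : S → ZMod p) :
      Abelianization.of
        (vec (act (scalar h9 1 : HoltGroup S p χ) u - u) : HoltGroup S p χ) = 1 := by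
    have h1 := congrArg Abelianization.of (mul_vec (scalar h9 1 : HoltGroup S p χ) u)
    rw [map_mul, map_mul, mul_comm] at h1
    have h2 := mul_right_cancel h1
    have h3 := congrArg Abelianization.of
      (vec_mul_vec (χ := χ) (act (scalar h9 1 : HoltGroup S p χ) u - u) u)
    rw [map_mul, sub_add_cancel, ← h2] at h3
    exact mul_eq_right.1 h3
  have h0 : χ 1 - 1 ≠ 0 := sub_ne_zero.2 hχ
  have hv : χ 1 • (χ 1 - 1)⁻¹ • v - (χ 1 - 1)⁻¹ • v = v := by
    funext t
    simp only [Pi.sub_apply, Pi.smul_apply, smul_eq_mul]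
    field_simp
  have := key ((χ 1 - 1)⁻¹ • v)
  rwa [act_scalar, hv] at this

variable [DecidableEq S]

lemma abelianization_of_edge (hS : commutator S = ⊤) (u : S) :
    Abelianization.of (edge u : HoltGroup S p χ) = 1 := by
  have hmul (a b : S) : Abelianization.of (edge (a * b) : HoltGroup S p χ) =
      Abelianization.of (edge a) * Abelianization.of (edge b) := by
    have h1 : (edge (a * b) * incl a : HoltGroup S p χ) = edge a * (incl a * edge b) := by
      ext t
      · simp [edge]
      · simp only [edge, mul_d, diag_d, incl_d, Pi.sub_apply, diag_s, incl_s, inv_one, one_mul,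
          Pi.zero_apply, add_zero, zero_add, Pi.single_apply, inv_mul_eq_iff_eq_mul, mul_one]
        ring
      · simp [edge]
    have h2 := congrArg Abelianization.of h1
    simpa [map_mul, abelianization_of_incl hS] using h2
  let f : S →* Abelianization (HoltGroup S p χ) :=
    MonoidHom.mk' (fun u => Abelianization.of (edge u)) hmul
  have : u ∈ commutator S := hS ▸ Subgroup.mem_top u
  exact Abelianization.commutator_subset_ker f this

/-- Diagonal parts whose diagonal element dies in the abelianization. -/
def trivialDiag (S : Type) [Group S] [Fintype S] (p : ℕ) (χ : AddChar (ZMod 9) (ZMod p)) :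
    AddSubmonoid (S → ZMod 9) where
  carrier := {d | ∃ h : ∑ t, d t = 0, Abelianization.of (diag d h : HoltGroup S p χ) = 1}
  zero_mem' := ⟨by simp, map_one _⟩
  add_mem' := by
    rintro a b ⟨ha, ha'⟩ ⟨hb, hb'⟩
    refine ⟨by simp [sum_add_distrib, ha, hb], ?_⟩
    rw [← diag_mul_diag a b ha hb, map_mul, ha', hb', one_mul]

lemma abelianization_of_diag (hS : commutator S = ⊤) (d : S → ZMod 9) (hd : ∑ t, d t = 0) :
    Abelianization.of (diag d hd : HoltGroup S p χ) = 1 := by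
  have h1 : d = ∑ u, (d u).val • (Pi.single u 1 - Pi.single 1 1 : S → ZMod 9) := by
    funext t
    have hval (u : S) : ((d u).val : ZMod 9) = d u := ZMod.natCast_zmod_val _
    simp [Finset.sum_apply, mul_sub, sum_sub_distrib, Pi.single_apply, hval, hd,
      -ZMod.natCast_val]
  have h2 : d ∈ trivialDiag S p χ := by
    rw [h1]
    refine sum_mem fun u _ => nsmul_mem ?_ _
    exact ⟨by simp, abelianization_of_edge hS u⟩
  exact h2.2

theorem commutator_eq_top (h9 : (Fintype.card S : ZMod 9) = 0) (hχ : χ 1 ≠ 1)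
    (hS : commutator S = ⊤) : commutator (HoltGroup S p χ) = ⊤ := by
  rw [eq_top_iff]
  intro g _
  have hg : g = vec g.w * diag g.d g.sum_d * incl g.s := by ext t <;> simp
  rw [← Abelianization.ker_of, MonoidHom.mem_ker, hg, map_mul, map_mul,
    abelianization_of_vec h9 hχ, abelianization_of_diag hS, abelianization_of_incl hS]
  simp

end Perfect

section Center

variable [Fact p.Prime] [Nontrivial S] [DecidableEq S]

lemma mem_center_iff (h9 : (Fintype.card S : ZMod 9) = 0) (hχ : χ 1 ≠ 1)
    {g : HoltGroup S p χ} :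
    g ∈ Subgroup.center (HoltGroup S p χ) ↔ ∃ c, χ c = 1 ∧ g = scalar h9 c := by
  rw [Subgroup.mem_center_iff]
  constructor
  · intro hg
    obtain ⟨hs, hd⟩ := s_eq_one_and_d_const (h := g) fun k => by rw [hg k]
    have hw : g.w = 0 := by
      funext t
      have := congrFun (congrArg w (hg (scalar h9 1))) t
      have h0 : (χ 1 - 1) * g.w t = 0 := by
        simp [hs] at this
        linear_combination this
      exact (mul_eq_zero.1 h0).resolve_left (sub_ne_zero.2 hχ)
    refine ⟨g.d 1, ?_, HoltGroup.ext hw (funext hd) hs⟩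
    have := congrFun (congrArg w (hg (vec 1))) 1
    simpa [hs, hw] using this.symm
  · rintro ⟨c, hc, rfl⟩ g
    ext t <;> simp [hc, add_comm]

lemma center_eq_zpowers (h9 : (Fintype.card S : ZMod 9) = 0) (hχ : χ 1 ≠ 1) (h3 : χ 3 = 1) :
    Subgroup.center (HoltGroup S p χ) = Subgroup.zpowers (scalar h9 3) := by
  apply le_antisymm
  · intro g hg
    obtain ⟨c, hc, rfl⟩ := (mem_center_iff h9 hχ).1 hg
    have key : ∀ c : ZMod 9, 3 * c = 0 → ∃ n : Fin 9, n.val • 3 = c := by decide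
    obtain ⟨n, rfl⟩ := key c (three_mul_eq_zero hχ hc)
    rw [← scalar_pow]
    exact Subgroup.npow_mem_zpowers _ _
  · rw [Subgroup.zpowers_le]
    exact (mem_center_iff h9 hχ).2 ⟨3, h3, rfl⟩

theorem card_center (h9 : (Fintype.card S : ZMod 9) = 0) (hχ : χ 1 ≠ 1) (h3 : χ 3 = 1) :
    Nat.card (Subgroup.center (HoltGroup S p χ)) = 3 := by
  rw [center_eq_zpowers h9 hχ h3, Nat.card_zpowers]
  apply orderOf_eq_prime
  · rw [scalar_pow]
    exact HoltGroup.ext rfl (funext fun _ => show (3 : ℕ) • (3 : ZMod 9) = 0 by decide) rfl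
  · intro h
    have : (3 : ZMod 9) = 0 := congrFun (congrArg d h) 1
    exact absurd this (by decide)

theorem map_center_eq (h9 : (Fintype.card S : ZMod 9) = 0) (hχ : χ 1 ≠ 1) (h3 : χ 3 = 1)
    (hp : (Fintype.card S * 9).Coprime p) (β : MulAut (HoltGroup S p χ))
    (z : HoltGroup S p χ) (hz : z ∈ Subgroup.center (HoltGroup S p χ)) : β z = z := by
  set ζ : HoltGroup S p χ := scalar h9 1 with hζ
  obtain ⟨hs, hd⟩ := s_eq_one_and_d_const (h := β ζ) fun g => by
    obtain ⟨k, rfl⟩ := β.surjective g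
    have hk : ζ * k = vec ((ζ * k).w - (k * ζ).w) * (k * ζ) :=
      eq_vec_mul (by funext t; simp [hζ, add_comm]) (by simp [hζ])
    obtain ⟨u, hu⟩ := exists_map_vec hp β ((ζ * k).w - (k * ζ).w)
    rw [← map_mul, hk, map_mul, hu, map_mul]
    funext t; simp
  have hχd : χ ((β ζ).d 1) = χ 1 := by
    obtain ⟨v, hv⟩ := exists_map_vec hp β.symm (1 : S → ZMod p)
    have hv' : β (vec v) = vec 1 := by rw [← hv]; exact β.apply_symm_apply _
    have h1 := congrArg β (mul_vec ζ v)
    rw [hζ, act_scalar, ← hζ, show χ 1 • v = (χ 1).val • v by funext t; simp, ← vec_pow,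
      map_mul, map_mul, map_pow, hv', mul_vec, vec_pow] at h1
    have h2 := congrFun (vec_injective (mul_right_cancel h1)) 1
    simpa [act] using h2
  have h3d : 3 * (β ζ).d 1 = 3 := by
    have h : χ ((β ζ).d 1 - 1) = 1 := by
      rw [AddChar.map_sub_eq_div, hχd, div_self (char_ne_zero 1)]
    linear_combination three_mul_eq_zero hχ h
  have hζ3 : ζ ^ 3 = scalar h9 3 := by
    rw [hζ, scalar_pow]; rfl
  have hfix : β (scalar h9 3) = scalar h9 3 := by
    have hc : β (scalar h9 3) ∈ Subgroup.center (HoltGroup S p χ) := by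
      have hm : scalar h9 3 ∈ Subgroup.center (HoltGroup S p χ) :=
        (mem_center_iff h9 hχ).2 ⟨3, h3, rfl⟩
      rw [Subgroup.mem_center_iff] at hm ⊢
      intro g
      obtain ⟨k, rfl⟩ := β.surjective g
      rw [← map_mul, ← map_mul, hm]
    obtain ⟨c, -, hc⟩ := (mem_center_iff h9 hχ).1 hc
    have h1 : ((β ζ) ^ 3).d 1 = c := by rw [← map_pow, hζ3, hc]; rfl
    rw [(pow_s_and_pow_d hs 3).2] at h1
    have h2 : c = 3 := by rw [← h1, ← h3d]; simp
    rw [hc, h2]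
  rw [center_eq_zpowers h9 hχ h3] at hz
  obtain ⟨n, rfl⟩ := hz
  simp only [map_zpow, hfix]

end Center

section Indecomposable

variable [Fact p.Prime]

/-- If `A` and `B` commute and generate, then `(a - 1)(b - 1)` kills every vector. -/
lemma act_act_sub {A B : Subgroup (HoltGroup S p χ)} (hc : ∀ a ∈ A, ∀ b ∈ B, a * b = b * a)
    (hAB : ∀ q, ∃ a ∈ A, ∃ b ∈ B, q = a * b) {a b : HoltGroup S p χ} (ha : a ∈ A) (hb : b ∈ B)
    (v : S → ZMod p) : act a (act b v - v) = act b v - v := by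
  have hmem : (vec (act b v - v) : HoltGroup S p χ) ∈ B := by
    obtain ⟨x, hx, y, hy, hxy⟩ := hAB (vec v)
    have h1 : (vec (act b v - v) : HoltGroup S p χ) * vec v = b * vec v * b⁻¹ := by
      rw [vec_mul_vec, sub_add_cancel, mul_vec, mul_inv_cancel_right]
    have h2 : (vec (act b v - v) : HoltGroup S p χ) = b * y * b⁻¹ * y⁻¹ := by
      have hxb := hc x hx b hb
      have hxc := hc x hx _ (B.mul_mem (B.mul_mem (B.mul_mem hb hy) (B.inv_mem hb)) (B.inv_mem hy))
      calc (vec (act b v - v) : HoltGroup S p χ) = b * (x * y) * b⁻¹ * (x * y)⁻¹ := by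
            rw [eq_mul_inv_iff_mul_eq.2 h1, hxy]
        _ = b * x * y * b⁻¹ * y⁻¹ * x⁻¹ := by group
        _ = x * (b * y * b⁻¹ * y⁻¹) * x⁻¹ := by rw [← hxb]; group
        _ = b * y * b⁻¹ * y⁻¹ := by rw [hxc, mul_inv_cancel_right]
    rw [h2]
    exact B.mul_mem (B.mul_mem (B.mul_mem hb hy) (B.inv_mem hb)) (B.inv_mem hy)
  have h := hc a ha _ hmem
  rw [mul_vec] at h
  exact vec_injective (mul_right_cancel h)

variable [DecidableEq S]

lemma s_eq_one_or (hp2 : p ≠ 2) (h3 : χ 3 = 1)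
    {A B : Subgroup (HoltGroup S p χ)} (hc : ∀ a ∈ A, ∀ b ∈ B, a * b = b * a)
    (hAB : ∀ q, ∃ a ∈ A, ∃ b ∈ B, q = a * b) {a b : HoltGroup S p χ} (ha : a ∈ A) (hb : b ∈ B) :
    a.s = 1 ∨ b.s = 1 := by
  by_contra! hne
  have h := congrFun (act_act_sub hc hAB ha hb (Pi.single 1 1)) 1
  have ha' : a.s⁻¹ ≠ 1 := by simpa using hne.1
  have hb' : b.s⁻¹ ≠ 1 := by simpa using hne.2
  simp only [act, mul_one, Pi.sub_apply, Pi.single_apply, ha', hb', if_true, if_false,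
    mul_zero, sub_zero, zero_sub] at h
  split_ifs at h
  · rw [mul_one, ← AddChar.map_add_eq_mul] at h
    set c := a.d 1 + b.d a.s⁻¹
    have hcube : χ c ^ 3 = 1 := by
      have key : ∀ c : ZMod 9, ∃ n : Fin 9, 3 • c = n.val • 3 := by decide
      obtain ⟨n, hn⟩ := key c
      rw [← AddChar.map_nsmul_eq_pow, hn, AddChar.map_nsmul_eq_pow, h3, one_pow]
    have h2 : (2 : ZMod p) = 0 := by
      rw [h] at hcube
      linear_combination -hcube
    have h2' : ((2 : ℕ) : ZMod p) = 0 := by exact_mod_cast h2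
    rw [ZMod.natCast_eq_zero_iff] at h2'
    exact hp2 ((Nat.prime_dvd_prime_iff_eq Fact.out Nat.prime_two).1 h2')
  · simp at h

variable [Nontrivial S]

lemma le_center_of_s_eq_one {A B : Subgroup (HoltGroup S p χ)}
    (hc : ∀ a ∈ A, ∀ b ∈ B, a * b = b * a) (hAB : ∀ q, ∃ a ∈ A, ∃ b ∈ B, q = a * b)
    (hA : ∀ a ∈ A, a.s = 1) : A ≤ Subgroup.center (HoltGroup S p χ) := by
  have hconst : ∀ a ∈ A, ∀ t, a.d t = a.d 1 := by
    intro a ha t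
    obtain ⟨x, hx, b, hb, hxb⟩ := hAB (incl t)
    have hbs : b.s = t := by simpa [hA x hx] using (congrArg s hxb).symm
    have := congrFun (congrArg d (hc a ha b hb)) t
    simp only [mul_d, hA a ha, hbs, inv_one, one_mul, inv_mul_cancel] at this
    rw [add_comm] at this
    exact add_left_cancel this
  have hact : ∀ a ∈ A, ∀ v, act a v = χ (a.d 1) • v := by
    intro a ha v
    funext t
    simp [act, hA a ha, hconst a ha t]
  have htriv : ∀ a ∈ A, χ (a.d 1) = 1 := by
    intro a ha
    by_contra hne
    have hB : ∀ b ∈ B, ∀ v, act b v = v := by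
      intro b hb v
      have h := act_act_sub hc hAB ha hb v
      rw [hact a ha, ← sub_eq_zero] at h
      have h' : (χ (a.d 1) - 1) • (act b v - v) = 0 := by rw [sub_smul, one_smul, h]
      exact sub_eq_zero.1 ((smul_eq_zero.1 h').resolve_left (sub_ne_zero.2 hne))
    obtain ⟨u, hu⟩ := exists_ne (1 : S)
    obtain ⟨x, hx, b, hb, hxb⟩ := hAB (incl u)
    have h := congrFun (act_mul x b (Pi.single 1 1)) 1
    rw [hB b hb, hact x hx, ← hxb] at h
    simp [act, hu] at h
    exact char_ne_zero _ h.symm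
  intro a ha
  rw [Subgroup.mem_center_iff]
  intro g
  obtain ⟨x, hx, b, hb, rfl⟩ := hAB g
  have hax : x * a = a * x := by
    ext t
    · simp [hA a ha, hA x hx, hconst a ha t, hconst x hx t, htriv a ha, htriv x hx, add_comm]
    · simp [hA a ha, hA x hx, add_comm]
    · simp [hA a ha, hA x hx]
  rw [mul_assoc, ← hc a ha b hb, ← mul_assoc, hax, mul_assoc]

theorem centrallyIndecomposable (hp2 : p ≠ 2) (h3 : χ 3 = 1) :
    CentrallyIndecomposable (HoltGroup S p χ) := by
  intro A B hc hAB
  by_cases hA : ∀ a ∈ A, a.s = 1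
  · exact Or.inl (le_center_of_s_eq_one hc hAB hA)
  · push Not at hA
    obtain ⟨a, ha, hne⟩ := hA
    refine Or.inr (le_center_of_s_eq_one (fun b hb a ha => (hc a ha b hb).symm) (fun q => ?_)
      fun b hb => (s_eq_one_or hp2 h3 hc hAB ha hb).resolve_left hne)
    obtain ⟨a, ha, b, hb, rfl⟩ := hAB q
    exact ⟨b, hb, a, ha, hc a ha b hb⟩

end Indecomposable

theorem exists_quotient_pow_eq_one [Fact p.Prime] [Nontrivial S] [DecidableEq S]
    (h9 : (Fintype.card S : ZMod 9) = 0) (hχ : χ 1 ≠ 1) :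
    ∃ x : HoltGroup S p χ ⧸ Subgroup.center (HoltGroup S p χ), x ≠ 1 ∧ x ^ p = 1 := by
  refine ⟨QuotientGroup.mk (vec 1), ?_, ?_⟩
  · rw [Ne, QuotientGroup.eq_one_iff, mem_center_iff h9 hχ]
    rintro ⟨c, -, h⟩
    have := congrFun (congrArg w h) 1
    simp at this
  · rw [← QuotientGroup.mk_pow, vec_pow]
    have : (vec (p • 1) : HoltGroup S p χ) = 1 := by ext t <;> simp
    rw [this]; rfl

end HoltGroup

open HoltGroup

lemma exists_char {p : ℕ} [Fact p.Prime] (hp : p % 3 = 1) :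
    ∃ χ : AddChar (ZMod 9) (ZMod p), χ 1 ≠ 1 ∧ χ 3 = 1 := by
  have hdvd : 3 ∣ Nat.card (ZMod p)ˣ := by
    rw [Nat.card_eq_fintype_card, ZMod.card_units p]
    omega
  have : Fact (Nat.Prime 3) := ⟨Nat.prime_three⟩
  obtain ⟨u, hu⟩ := exists_prime_orderOf_dvd_card' 3 hdvd
  have h3 : (u : ZMod p) ^ 3 = 1 := by
    rw [← Units.val_pow_eq_pow_val, ← hu, pow_orderOf_eq_one, Units.val_one]
  have h9 : (u : ZMod p) ^ 9 = 1 := by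
    rw [show 9 = 3 * 3 from rfl, pow_mul, h3, one_pow]
  refine ⟨AddChar.zmodChar 9 h9, ?_, ?_⟩
  · have := AddChar.zmodChar_apply' h9 1
    rw [Nat.cast_one, pow_one] at this
    rw [this, Ne, Units.val_eq_one]
    rintro rfl
    simp at hu
  · have := AddChar.zmodChar_apply' h9 3
    rwa [h3] at this

lemma coprime_of_mod_three {p : ℕ} (hp : p.Prime) (h : p % 3 = 1) : (360 * 9).Coprime p := by
  rw [Nat.coprime_comm, hp.coprime_iff_not_dvd]
  intro hd
  have hd' : p ∣ 2 ^ 3 * 3 ^ 4 * 5 := hd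
  rw [hp.dvd_mul, hp.dvd_mul] at hd'
  have hle : p ≤ 5 := by
    rcases hd' with (hd' | hd') | hd'
    · exact (Nat.le_of_dvd two_pos (hp.dvd_of_dvd_pow hd')).trans (by norm_num)
    · exact (Nat.le_of_dvd three_pos (hp.dvd_of_dvd_pow hd')).trans (by norm_num)
    · exact Nat.le_of_dvd (by norm_num) hd'
  interval_cases p <;> revert hp h <;> norm_num

lemma exists_holt_group (p : ℕ) : ∃ (G : Type) (_ : Group G), p.Prime → p % 3 = 1 →
    (Finite G ∧ commutator G = ⊤ ∧ CentrallyIndecomposable G ∧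
      Nat.card (Subgroup.center G) = 3 ∧
      ∀ β : MulAut G, ∀ z ∈ Subgroup.center G, β z = z) ∧
    (∃ x : G ⧸ Subgroup.center G, x ≠ 1 ∧ x ^ p = 1) ∧ ∀ g : G, g ^ (360 * 9 * p) = 1 := by
  by_cases h : p.Prime ∧ p % 3 = 1
  · obtain ⟨hp, hmod⟩ := h
    have : Fact p.Prime := ⟨hp⟩
    obtain ⟨χ, hχ, h3⟩ := exists_char hmod
    have hcard : Fintype.card (alternatingGroup (Fin 6)) = 360 := by
      rw [card_alternatingGroup]
      simp [Nat.factorial]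
    have : Nontrivial (alternatingGroup (Fin 6)) :=
      Fintype.one_lt_card_iff_nontrivial.1 (by rw [hcard]; norm_num)
    have h9 : (Fintype.card (alternatingGroup (Fin 6)) : ZMod 9) = 0 := by
      rw [hcard]; rfl
    have hcop := coprime_of_mod_three hp hmod
    refine ⟨HoltGroup (alternatingGroup (Fin 6)) p χ, inferInstance, fun _ _ =>
      ⟨⟨inferInstance, commutator_eq_top h9 hχ ?_, centrallyIndecomposable ?_ h3,
        card_center h9 hχ h3, map_center_eq h9 hχ h3 (hcard ▸ hcop)⟩,
        exists_quotient_pow_eq_one h9 hχ, fun g => hcard ▸ pow_eq_one g⟩⟩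
    · exact commutator_alternatingGroup_eq_top (by simp)
    · rintro rfl
      norm_num at hmod
  · exact ⟨Unit, inferInstance, fun h1 h2 => absurd ⟨h1, h2⟩ h⟩

end HoltFamily

/-- Proposition 7.13 (after Derek Holt): there is a family of finite groups
`L_p`, for `p ≡ 1 (mod 3)` prime, which are perfect and centrally
indecomposable, have center of order `3` fixed pointwise by every automorphism,
and have pairwise non-isomorphic central quotients. -/
theorem exists_holt_family :
    ∃ (L : ℕ → Type) (_ : ∀ p, Group (L p)),
      (∀ p : ℕ, p.Prime → p % 3 = 1 →
        Finite (L p) ∧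
        commutator (L p) = ⊤ ∧
        CentrallyIndecomposable (L p) ∧
        Nat.card (Subgroup.center (L p)) = 3 ∧
        (∀ β : MulAut (L p), ∀ z ∈ Subgroup.center (L p), β z = z)) ∧
      (∀ p q : ℕ, p.Prime → q.Prime → p % 3 = 1 → q % 3 = 1 → p ≠ q →
        IsEmpty ((L p ⧸ Subgroup.center (L p)) ≃* (L q ⧸ Subgroup.center (L q)))) := by
  choose L inst h using HoltFamily.exists_holt_group
  refine ⟨L, inst, fun p hp hmod => (h p hp hmod).1, fun p q hp hq hpm hqm hpq => ⟨fun e => ?_⟩⟩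
  obtain ⟨x, hx, hxp⟩ := (h p hp hpm).2.1
  have h1 : e x ^ p = 1 := by rw [← map_pow, hxp, map_one]
  have h2 : e x ^ (360 * 9 * q) = 1 := by
    obtain ⟨g, hg⟩ := QuotientGroup.mk_surjective (e x)
    rw [← hg, ← QuotientGroup.mk_pow, (h q hq hqm).2.2 g, QuotientGroup.mk_one]
  have hcop : (360 * 9 * q).Coprime p :=
    (HoltFamily.coprime_of_mod_three hp hpm).mul_left ((Nat.coprime_primes hq hp).2 hpq.symm)
  have h3 := pow_gcd_eq_one.2 ⟨h2, h1⟩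
  rw [hcop, pow_one] at h3
  exact hx (e.map_eq_one_iff.1 h3)
end
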